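/- Let (A, φ) be a C*-probability space with faithful tracial φ, let (X_i)_{i∈ℕ} be free self-adjoint elements of A with φ(X_i) = 0 and φ(X_i²) = σ_i², B_n² := ∑_{i=1}^n σ_i² > 0 for all n, and suppose L_{S,4n} → 0 as n → ∞. Set S_n := B_n^{−1} ∑_{i=1}^n X_i and let V_n be the positive square root of V_n² := B_n^{−2} ∑_{i=1}^n X_i². Let s be a standard semicircular element of a C*-probability space (B, ψ) with faithful tracial ψ. Then (S_n, V_n) converges strongly to (s, 1): for every polynomial P in two non-commuting variables, φ( P(S_n, V_n) ) → ψ( P(s, 1) ) and ‖ P(S_n, V_n) ‖_A → ‖ P(s, 1) ‖_B as n → ∞. In particular, φ(U_n^k) → ψ(s^k) for every k ∈ ℕ, where U_n := V_n^{−1/2} S_n V_n^{−1/2} (well-defined for large n). -/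

import Mathlib

open MeasureTheory Filter Topology

noncomputable section

/-- Wigner's semicircle law: density `(2π)⁻¹ √(4 - t²)` on `[-2, 2]`. -/
def semicircleLaw : Measure ℝ :=
  volume.withDensity fun t =>
    ENNReal.ofReal (Set.indicator (Set.Icc (-2 : ℝ) 2)
      (fun t => (2 * Real.pi)⁻¹ * Real.sqrt (4 - t ^ 2)) t)

/-- Distribution function of a measure on `ℝ`. -/
def cdf (μ : Measure ℝ) (x : ℝ) : ℝ := (μ (Set.Iic x)).toReal

/-- Kolmogorov distance. -/
def kolDist (μ ν : Measure ℝ) : ℝ := ⨆ x : ℝ, |cdf μ x - cdf ν x|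

/-- Cauchy transform. -/
def cauchyG (μ : Measure ℝ) (z : ℂ) : ℂ := ∫ t, (z - (t : ℂ))⁻¹ ∂μ

/-- Support of a measure on `ℝ`. -/
def msupport (μ : Measure ℝ) : Set ℝ :=
  {x : ℝ | ∀ U : Set ℝ, IsOpen U → x ∈ U → 0 < μ U}

variable {A : Type*}

/-- `φ` is a state: unital and positive. -/
def IsState [Ring A] [StarRing A] [Algebra ℂ A] (φ : A →ₗ[ℂ] ℂ) : Prop :=
  φ 1 = 1 ∧ ∀ x : A, 0 ≤ (φ (star x * x)).re ∧ (φ (star x * x)).im = 0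

/-- `φ` is tracial. -/
def IsTracial [Ring A] [Algebra ℂ A] (φ : A →ₗ[ℂ] ℂ) : Prop :=
  ∀ x y : A, φ (x * y) = φ (y * x)

/-- `φ` is faithful. -/
def IsFaithful [Ring A] [StarRing A] [Algebra ℂ A] (φ : A →ₗ[ℂ] ℂ) : Prop :=
  ∀ x : A, φ (star x * x) = 0 → x = 0

/-- Freeness of a family of unital subalgebras w.r.t. `φ`. -/
def IsFreeFamily [Ring A] [Algebra ℂ A] (φ : A →ₗ[ℂ] ℂ)
    {I : Type*} (S : I → Subalgebra ℂ A) : Prop :=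
  ∀ (k : ℕ) (idx : Fin (k + 1) → I),
    (∀ j : Fin k, idx j.castSucc ≠ idx j.succ) →
    ∀ x : Fin (k + 1) → A, (∀ j, x j ∈ S (idx j)) → (∀ j, φ (x j) = 0) →
      φ (List.ofFn x).prod = 0

/-- Freeness of a family of elements: the generated unital subalgebras are free. -/
def AreFree [Ring A] [Algebra ℂ A] (φ : A →ₗ[ℂ] ℂ) {I : Type*} (X : I → A) : Prop :=
  IsFreeFamily φ fun i => Algebra.adjoin ℂ {X i}

/-- `μ` is the analytic distribution of `x`: a probability measure whose moments are the
`φ`-moments of `x`. -/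
def IsDistribution [Ring A] [Algebra ℂ A] (φ : A →ₗ[ℂ] ℂ) (x : A) (μ : Measure ℝ) : Prop :=
  IsProbabilityMeasure μ ∧ ∀ k : ℕ, φ (x ^ k) = ((∫ t, t ^ k ∂μ : ℝ) : ℂ)

/-- The Lyapunov-type fraction `L_{S,kn} = (∑_{i<n} ‖X i‖ ^ k) / B_n ^ k`. -/
def Lsn [Norm A] (X : ℕ → A) (σ : ℕ → ℝ) (k n : ℕ) : ℝ :=
  (∑ i ∈ Finset.range n, ‖X i‖ ^ k) /
    Real.sqrt (∑ i ∈ Finset.range n, σ i ^ 2) ^ k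

/-- `s` is a standard semicircular element. -/
def IsStdSemicircular [Ring A] [StarRing A] [Algebra ℂ A] (φ : A →ₗ[ℂ] ℂ) (s : A) : Prop :=
  IsSelfAdjoint s ∧ ∀ k : ℕ, φ (s ^ k) = ((∫ t, t ^ k ∂semicircleLaw : ℝ) : ℂ)

end

section Creation

open scoped InnerProductSpace

/-- Operators `z i` that, relative to mutually orthogonal projections `P i`, act on the subspace
`E` like free centred variables act on a free product space: `z i` maps the vectors of `E` that are
orthogonal to the range of `P i` into that range, and the compression of `z i ^ 2` to them is the
scalar `v i`. -/
structure IsCreationSystem {H : Type*} [NormedAddCommGroup H] [InnerProductSpace ℂ H]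
    {ι : Type*} (P z : ι → H →ₗ[ℂ] H) (v : ι → ℝ) (E : Submodule ℂ H) : Prop where
  proj_symm : ∀ i ξ η, ⟪P i ξ, η⟫_ℂ = ⟪ξ, P i η⟫_ℂ
  proj_idem : ∀ i ξ, P i (P i ξ) = P i ξ
  proj_orth : ∀ i j, i ≠ j → ∀ ξ, P i (P j ξ) = 0
  symm : ∀ i ξ η, ⟪z i ξ, η⟫_ℂ = ⟪ξ, z i η⟫_ℂ
  proj_mem : ∀ i, ∀ ξ ∈ E, P i ξ ∈ E
  mem : ∀ i, ∀ ξ ∈ E, z i ξ ∈ E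
  create : ∀ i, ∀ ξ ∈ E, P i (z i (ξ - P i ξ)) = z i (ξ - P i ξ)
  compress : ∀ i, ∀ ξ ∈ E, z i (z i (ξ - P i ξ)) - P i (z i (z i (ξ - P i ξ))) =
    (v i : ℂ) • (ξ - P i ξ)

namespace IsCreationSystem

variable {H : Type*} [NormedAddCommGroup H] [InnerProductSpace ℂ H]
    {ι : Type*} {P z : ι → H →ₗ[ℂ] H} {v : ι → ℝ} {E : Submodule ℂ H}

/-- The creation part of `∑ i ∈ F, z i`. -/
def up (P z : ι → H →ₗ[ℂ] H) (F : Finset ι) : H →ₗ[ℂ] H :=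
  ∑ i ∈ F, P i ∘ₗ z i ∘ₗ (LinearMap.id - P i)

/-- The annihilation part of `∑ i ∈ F, z i`. -/
def down (P z : ι → H →ₗ[ℂ] H) (F : Finset ι) : H →ₗ[ℂ] H :=
  ∑ i ∈ F, (LinearMap.id - P i) ∘ₗ z i ∘ₗ P i

/-- The diagonal part of `∑ i ∈ F, z i`. -/
def diag (P z : ι → H →ₗ[ℂ] H) (F : Finset ι) : H →ₗ[ℂ] H :=
  ∑ i ∈ F, P i ∘ₗ z i ∘ₗ P i

lemma up_apply (F : Finset ι) (ξ : H) : up P z F ξ = ∑ i ∈ F, P i (z i (ξ - P i ξ)) := by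
  simp [up, LinearMap.sum_apply]

lemma down_apply (F : Finset ι) (ξ : H) :
    down P z F ξ = ∑ i ∈ F, (z i (P i ξ) - P i (z i (P i ξ))) := by
  simp [down, LinearMap.sum_apply]

lemma diag_apply (F : Finset ι) (ξ : H) : diag P z F ξ = ∑ i ∈ F, P i (z i (P i ξ)) := by
  simp [diag, LinearMap.sum_apply]

variable (h : IsCreationSystem P z v E) (F : Finset ι)
include h

lemma sum_eq {ξ : H} (hξ : ξ ∈ E) :
    ∑ i ∈ F, z i ξ = diag P z F ξ + up P z F ξ + down P z F ξ := by
  rw [diag_apply, up_apply, down_apply, ← Finset.sum_add_distrib, ← Finset.sum_add_distrib]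
  refine Finset.sum_congr rfl fun i _ => ?_
  rw [h.create i ξ hξ, map_sub]
  abel

lemma up_mem {ξ : H} (hξ : ξ ∈ E) : up P z F ξ ∈ E := by
  rw [up_apply]
  exact E.sum_mem fun i _ => h.proj_mem _ _ (h.mem _ _ (E.sub_mem hξ (h.proj_mem _ _ hξ)))

lemma down_mem {ξ : H} (hξ : ξ ∈ E) : down P z F ξ ∈ E := by
  rw [down_apply]
  exact E.sum_mem fun i _ => E.sub_mem (h.mem _ _ (h.proj_mem _ _ hξ))
    (h.proj_mem _ _ (h.mem _ _ (h.proj_mem _ _ hξ)))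

lemma inner_proj_proj {i j : ι} (hij : i ≠ j) (ξ η : H) : ⟪P i ξ, P j η⟫_ℂ = 0 := by
  rw [h.proj_symm, h.proj_orth i j hij, inner_zero_right]

lemma norm_sq_sum_proj (ξ : ι → H) :
    ‖∑ i ∈ F, P i (ξ i)‖ ^ 2 = ∑ i ∈ F, ‖P i (ξ i)‖ ^ 2 := by
  classical
  induction F using Finset.induction_on with
  | empty => simp
  | insert i F hi ih =>
    rw [Finset.sum_insert hi, Finset.sum_insert hi, ← ih, sq, sq, sq]
    refine norm_add_sq_eq_norm_sq_add_norm_sq_of_inner_eq_zero (𝕜 := ℂ) _ _ ?_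
    rw [inner_sum]
    refine Finset.sum_eq_zero fun j hj => h.inner_proj_proj ?_ _ _
    rintro rfl
    exact hi hj

lemma inner_proj_self (i : ι) (ξ : H) : ⟪ξ, P i ξ⟫_ℂ = ((‖P i ξ‖ ^ 2 : ℝ) : ℂ) := by
  rw [← h.proj_idem, ← h.proj_symm, inner_self_eq_norm_sq_to_K]
  simp [h.proj_idem]

lemma sum_norm_sq_proj_le (ξ : H) : ∑ i ∈ F, ‖P i ξ‖ ^ 2 ≤ ‖ξ‖ ^ 2 := by
  have h1 := h.norm_sq_sum_proj F fun _ => ξ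
  have h2 : ⟪ξ, ∑ i ∈ F, P i ξ⟫_ℂ = ((∑ i ∈ F, ‖P i ξ‖ ^ 2 : ℝ) : ℂ) := by
    rw [inner_sum, Complex.ofReal_sum]
    exact Finset.sum_congr rfl fun i _ => h.inner_proj_self i ξ
  have h3 := norm_inner_le_norm (𝕜 := ℂ) ξ (∑ i ∈ F, P i ξ)
  rw [h2, Complex.norm_real, ← h1, Real.norm_of_nonneg (by positivity)] at h3
  rw [← h1]
  nlinarith [norm_nonneg (∑ i ∈ F, P i ξ), norm_nonneg ξ, sq_nonneg (‖ξ‖ - ‖∑ i ∈ F, P i ξ‖)]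

lemma norm_proj_le (i : ι) (ξ : H) : ‖P i ξ‖ ≤ ‖ξ‖ := by
  have := h.sum_norm_sq_proj_le {i} ξ
  rw [Finset.sum_singleton] at this
  exact (sq_le_sq₀ (norm_nonneg _) (norm_nonneg _)).1 this

lemma norm_sum_proj_le {M : ℝ} (hM : 0 ≤ M) (T : ι → H → H)
    (hT : ∀ i ∈ F, ∀ ξ, ‖T i ξ‖ ≤ M * ‖ξ‖) (ξ : H) :
    ‖∑ i ∈ F, P i (T i (P i ξ))‖ ≤ M * ‖ξ‖ := by
  refine (sq_le_sq₀ (norm_nonneg _) (by positivity)).1 ?_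
  rw [h.norm_sq_sum_proj F fun i => T i (P i ξ), mul_pow]
  refine le_trans ?_ (mul_le_mul_of_nonneg_left (h.sum_norm_sq_proj_le F ξ) (sq_nonneg M))
  rw [Finset.mul_sum]
  refine Finset.sum_le_sum fun i hi => ?_
  rw [← mul_pow]
  exact pow_le_pow_left₀ (norm_nonneg _) ((h.norm_proj_le _ _).trans (hT i hi _)) 2

lemma norm_diag_le {M : ℝ} (hM : 0 ≤ M) (hz : ∀ i ∈ F, ∀ ξ, ‖z i ξ‖ ≤ M * ‖ξ‖) (ξ : H) :
    ‖diag P z F ξ‖ ≤ M * ‖ξ‖ := by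
  rw [diag_apply]
  exact h.norm_sum_proj_le F hM (fun i => z i) hz ξ

lemma inner_down (ξ η : H) : ⟪down P z F ξ, η⟫_ℂ = ⟪ξ, up P z F η⟫_ℂ := by
  rw [down_apply, up_apply, sum_inner, inner_sum]
  refine Finset.sum_congr rfl fun i _ => ?_
  rw [inner_sub_left, h.proj_symm, ← inner_sub_right, h.symm, h.proj_symm]

lemma down_up {ξ : H} (hξ : ξ ∈ E) :
    down P z F (up P z F ξ) = ∑ i ∈ F, (v i : ℂ) • (ξ - P i ξ) := by
  classical
  rw [down_apply]
  refine Finset.sum_congr rfl fun i hi => ?_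
  have : P i (up P z F ξ) = z i (ξ - P i ξ) := by
    rw [up_apply, map_sum, Finset.sum_eq_single i, h.proj_idem, h.create i ξ hξ]
    · exact fun j _ hji => h.proj_orth i j hji.symm _
    · exact fun hn => absurd hi hn
  rw [this, h.compress i ξ hξ]

lemma norm_up_le (hv : ∀ i, 0 ≤ v i) {ξ : H} (hξ : ξ ∈ E) :
    ‖up P z F ξ‖ ≤ √(∑ i ∈ F, v i) * ‖ξ‖ := by
  have hs : 0 ≤ ∑ i ∈ F, v i := Finset.sum_nonneg fun i _ => hv i
  refine (sq_le_sq₀ (norm_nonneg _) (by positivity)).1 ?_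
  rw [mul_pow, Real.sq_sqrt hs, Finset.sum_mul]
  have h1 : ⟪ξ, ∑ i ∈ F, (v i : ℂ) • (ξ - P i ξ)⟫_ℂ =
      ((∑ i ∈ F, v i * (‖ξ‖ ^ 2 - ‖P i ξ‖ ^ 2) : ℝ) : ℂ) := by
    rw [inner_sum, Complex.ofReal_sum]
    refine Finset.sum_congr rfl fun i _ => ?_
    rw [inner_smul_right, inner_sub_right, h.inner_proj_self, inner_self_eq_norm_sq_to_K]
    push_cast
    rfl
  have h2 : ⟪up P z F ξ, up P z F ξ⟫_ℂ = ⟪down P z F (up P z F ξ), ξ⟫_ℂ :=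
    (h.inner_down F _ _).symm
  rw [h.down_up F hξ, ← inner_conj_symm _ ξ, h1, Complex.conj_ofReal,
    inner_self_eq_norm_sq_to_K, RCLike.ofReal_eq_complex_ofReal] at h2
  have h3 : ‖up P z F ξ‖ ^ 2 = ∑ i ∈ F, v i * (‖ξ‖ ^ 2 - ‖P i ξ‖ ^ 2) := by
    exact_mod_cast h2
  rw [h3]
  exact Finset.sum_le_sum fun i _ => mul_le_mul_of_nonneg_left
    (sub_le_self _ (sq_nonneg _)) (hv i)

lemma norm_down_le (hv : ∀ i, 0 ≤ v i) {ξ : H} (hξ : ξ ∈ E) :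
    ‖down P z F ξ‖ ≤ √(∑ i ∈ F, v i) * ‖ξ‖ := by
  rcases (norm_nonneg (down P z F ξ)).eq_or_lt with h0 | h0
  · rw [← h0]; positivity
  have h1 := norm_inner_le_norm (𝕜 := ℂ) ξ (up P z F (down P z F ξ))
  rw [← h.inner_down, inner_self_eq_norm_sq_to_K] at h1
  simp only [Complex.coe_algebraMap, norm_pow, Complex.norm_real, norm_norm] at h1
  have h2 := h.norm_up_le F hv (h.down_mem F hξ)
  refine le_of_mul_le_mul_right ?_ h0
  calc ‖down P z F ξ‖ * ‖down P z F ξ‖ = ‖down P z F ξ‖ ^ 2 := (sq _).symm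
    _ ≤ ‖ξ‖ * ‖up P z F (down P z F ξ)‖ := h1
    _ ≤ ‖ξ‖ * (√(∑ i ∈ F, v i) * ‖down P z F ξ‖) := by gcongr
    _ = _ := by ring

lemma norm_sum_le (hv : ∀ i, 0 ≤ v i) {M : ℝ} (hM : 0 ≤ M)
    (hz : ∀ i ∈ F, ∀ ξ, ‖z i ξ‖ ≤ M * ‖ξ‖) {ξ : H} (hξ : ξ ∈ E) :
    ‖∑ i ∈ F, z i ξ‖ ≤ (M + 2 * √(∑ i ∈ F, v i)) * ‖ξ‖ := by
  rw [h.sum_eq F hξ]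
  refine (norm_add₃_le).trans ?_
  linarith [h.norm_diag_le F hM hz ξ, h.norm_up_le F hv hξ, h.norm_down_le F hv hξ]

lemma norm_down_up_sub_le {M : ℝ} (hM : 0 ≤ M) (hv : ∀ i ∈ F, |v i| ≤ M)
    (hv1 : ∑ i ∈ F, v i = 1) {ξ : H} (hξ : ξ ∈ E) :
    ‖down P z F (up P z F ξ) - ξ‖ ≤ M * ‖ξ‖ := by
  have h1 : down P z F (up P z F ξ) - ξ = -∑ i ∈ F, P i ((v i : ℂ) • P i ξ) := by
    rw [h.down_up F hξ]
    simp only [smul_sub, Finset.sum_sub_distrib, map_smul, h.proj_idem, ← Finset.sum_smul,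
      ← Complex.ofReal_sum, hv1]
    simp
  rw [h1, norm_neg]
  refine h.norm_sum_proj_le F hM (fun i ξ => (v i : ℂ) • ξ) (fun i hi ξ => ?_) ξ
  rw [norm_smul, Complex.norm_real]
  exact mul_le_mul_of_nonneg_right (hv i hi) (norm_nonneg _)

lemma sum_mem {ξ : H} (hξ : ξ ∈ E) : (∑ i ∈ F, z i) ξ ∈ E := by
  rw [LinearMap.sum_apply]
  exact E.sum_mem fun i _ => h.mem i ξ hξ

lemma aeval_mem (p : Polynomial ℂ) {ξ : H} (hξ : ξ ∈ E) :
    Polynomial.aeval (∑ i ∈ F, z i : Module.End ℂ H) p ξ ∈ E := by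
  induction p using Polynomial.induction_on' with
  | add p q hp hq => simpa using E.add_mem hp hq
  | monomial n c =>
    rw [Polynomial.aeval_monomial, Module.End.mul_apply, Module.algebraMap_end_apply]
    refine E.smul_mem _ ?_
    induction n with
    | zero => simpa using hξ
    | succ n ih =>
      rw [pow_succ', Module.End.mul_apply]
      exact h.sum_mem F ih

lemma pow_up_mem (m : ℕ) {ξ : H} (hξ : ξ ∈ E) : (up P z F ^ m) ξ ∈ E := by
  induction m with
  | zero => simpa using hξ
  | succ m ih =>
    rw [pow_succ', Module.End.mul_apply]
    exact h.up_mem F ih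

lemma norm_pow_up_le (hv : ∀ i, 0 ≤ v i) (hv1 : ∑ i ∈ F, v i = 1) (m : ℕ) {ξ : H}
    (hξ : ξ ∈ E) : ‖(up P z F ^ m) ξ‖ ≤ ‖ξ‖ := by
  induction m with
  | zero => simp
  | succ m ih =>
    rw [pow_succ', Module.End.mul_apply]
    refine (h.norm_up_le F hv (h.pow_up_mem F m hξ)).trans ?_
    simpa [hv1] using ih

open Polynomial.Chebyshev in
/-- Chebyshev polynomials in `∑ i ∈ F, z i` act on a vacuum vector almost like powers of the
creation part. -/
lemma norm_aeval_S_sub_le (hv : ∀ i, 0 ≤ v i) (hv1 : ∑ i ∈ F, v i = 1) {M : ℝ} (hM : 0 ≤ M)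
    (hM1 : M ≤ 1) (hz : ∀ i ∈ F, ∀ ξ, ‖z i ξ‖ ≤ M * ‖ξ‖) (hvM : ∀ i ∈ F, |v i| ≤ M)
    {Ω : H} (hΩ : Ω ∈ E) (hPΩ : ∀ i, P i Ω = 0) (m : ℕ) :
    ‖Polynomial.aeval (∑ i ∈ F, z i : Module.End ℂ H) (S ℂ m) Ω - (up P z F ^ m) Ω‖
      ≤ 4 ^ m * (M * ‖Ω‖) := by
  have hMΩ : 0 ≤ M * ‖Ω‖ := by positivity
  induction m using Nat.twoStepInduction with
  | zero => simpa using hMΩ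
  | one =>
    have h1 := h.sum_eq F hΩ
    rw [diag_apply, down_apply] at h1
    simp only [hPΩ, map_zero, sub_zero, Finset.sum_const_zero, zero_add, add_zero] at h1
    simp [h1, hMΩ]
  | more m ih0 ih1 =>
    set T : Module.End ℂ H := ∑ i ∈ F, z i with hT
    set a := up P z F with ha
    have e1 : Polynomial.aeval T (S ℂ ((m + 2 : ℕ) : ℤ)) Ω =
        T (Polynomial.aeval T (S ℂ ((m + 1 : ℕ) : ℤ)) Ω) - Polynomial.aeval T (S ℂ (m : ℤ)) Ω := by
      push_cast
      rw [S_add_two, map_sub, map_mul, Polynomial.aeval_X, LinearMap.sub_apply,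
        Module.End.mul_apply]
    set x1 := Polynomial.aeval T (S ℂ ((m + 1 : ℕ) : ℤ)) Ω with hx1
    set x0 := Polynomial.aeval T (S ℂ (m : ℤ)) Ω with hx0
    have hmE : (a ^ m) Ω ∈ E := h.pow_up_mem F m hΩ
    have hm1E : (a ^ (m + 1)) Ω ∈ E := h.pow_up_mem F (m + 1) hΩ
    have e2 : T ((a ^ (m + 1)) Ω) = diag P z F ((a ^ (m + 1)) Ω) + (a ^ (m + 2)) Ω +
        down P z F (a ((a ^ m) Ω)) := by
      rw [hT, LinearMap.sum_apply, h.sum_eq F hm1E, pow_succ' a (m + 1), pow_succ' a m]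
      rfl
    have e3 : Polynomial.aeval T (S ℂ ((m + 2 : ℕ) : ℤ)) Ω - (a ^ (m + 2)) Ω =
        T (x1 - (a ^ (m + 1)) Ω) - (x0 - (a ^ m) Ω) + diag P z F ((a ^ (m + 1)) Ω) +
          (down P z F (a ((a ^ m) Ω)) - (a ^ m) Ω) := by
      rw [e1, map_sub, e2]
      abel
    have n1 : ‖T (x1 - (a ^ (m + 1)) Ω)‖ ≤ 3 * ‖x1 - (a ^ (m + 1)) Ω‖ := by
      have := h.norm_sum_le F hv hM hz (E.sub_mem (h.aeval_mem F (S ℂ ((m + 1 : ℕ) : ℤ)) hΩ) hm1E)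
      rw [hv1, Real.sqrt_one, ← LinearMap.sum_apply] at this
      exact this.trans (mul_le_mul_of_nonneg_right (by linarith) (norm_nonneg _))
    have n2 : ‖diag P z F ((a ^ (m + 1)) Ω)‖ ≤ M * ‖Ω‖ :=
      (h.norm_diag_le F hM hz _).trans
        (mul_le_mul_of_nonneg_left (h.norm_pow_up_le F hv hv1 _ hΩ) hM)
    have n3 : ‖down P z F (a ((a ^ m) Ω)) - (a ^ m) Ω‖ ≤ M * ‖Ω‖ :=
      (h.norm_down_up_sub_le F hM hvM hv1 hmE).trans
        (mul_le_mul_of_nonneg_left (h.norm_pow_up_le F hv hv1 _ hΩ) hM)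
    have n4 : (1 : ℝ) ≤ 4 ^ m := one_le_pow₀ (by norm_num)
    rw [e3]
    refine (norm_add_le _ _).trans ((add_le_add_left ((norm_add_le _ _).trans
      (add_le_add_left (norm_sub_le _ _) _)) _).trans ?_)
    have n5 : (4 : ℝ) ^ (m + 1) = 4 * 4 ^ m := pow_succ' _ _
    have n6 : (4 : ℝ) ^ (m + 2) = 16 * 4 ^ m := by ring
    rw [n5] at ih1
    rw [n6]
    nlinarith [mul_le_mul_of_nonneg_right n4 hMΩ]

open Polynomial.Chebyshev in
lemma norm_inner_aeval_S_le (hv : ∀ i, 0 ≤ v i) (hv1 : ∑ i ∈ F, v i = 1) {M : ℝ} (hM : 0 ≤ M)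
    (hM1 : M ≤ 1) (hz : ∀ i ∈ F, ∀ ξ, ‖z i ξ‖ ≤ M * ‖ξ‖) (hvM : ∀ i ∈ F, |v i| ≤ M)
    {Ω : H} (hΩ : Ω ∈ E) (hPΩ : ∀ i, P i Ω = 0) (hΩ1 : ‖Ω‖ = 1) {m : ℕ} (hm : m ≠ 0) :
    ‖⟪Ω, Polynomial.aeval (∑ i ∈ F, z i : Module.End ℂ H) (S ℂ m) Ω⟫_ℂ‖ ≤ 4 ^ m * M := by
  have h1 := h.norm_aeval_S_sub_le F hv hv1 hM hM1 hz hvM hΩ hPΩ m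
  have h0 : ⟪Ω, (up P z F ^ m) Ω⟫_ℂ = 0 := by
    obtain ⟨k, rfl⟩ := Nat.exists_eq_succ_of_ne_zero hm
    rw [pow_succ', Module.End.mul_apply, ← h.inner_down, down_apply]
    simp [hPΩ]
  rw [← sub_zero ⟪Ω, _⟫_ℂ, ← h0, ← inner_sub_right]
  refine (norm_inner_le_norm _ _).trans ?_
  simpa [hΩ1] using h1

end IsCreationSystem

end Creation

section FreeWords

variable {A : Type*} [Ring A] [Algebra ℂ A] {I : Type*}

/-- A list of labelled elements is reduced if neighbouring labels differ and every entry is a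
centred element of the subalgebra with its label. -/
def IsReducedWord (φ : A →ₗ[ℂ] ℂ) (𝒜 : I → Subalgebra ℂ A) (l : List (I × A)) : Prop :=
  l.IsChain (fun p q => p.1 ≠ q.1) ∧ ∀ p ∈ l, p.2 ∈ 𝒜 p.1 ∧ φ p.2 = 0

/-- The product of the entries of a labelled list. -/
def wordProd (l : List (I × A)) : A := (l.map Prod.snd).prod

/-- The span of the reduced words that start with label `i`. -/
def startSpan (φ : A →ₗ[ℂ] ℂ) (𝒜 : I → Subalgebra ℂ A) (i : I) : Submodule ℂ A :=
  Submodule.span ℂ {a | ∃ l, IsReducedWord φ 𝒜 l ∧ (∃ p ∈ l.head?, p.1 = i) ∧ wordProd l = a}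

/-- The span of the reduced words that do not start with label `i`. -/
def avoidSpan (φ : A →ₗ[ℂ] ℂ) (𝒜 : I → Subalgebra ℂ A) (i : I) : Submodule ℂ A :=
  Submodule.span ℂ {a | ∃ l, IsReducedWord φ 𝒜 l ∧ (∀ p ∈ l.head?, p.1 ≠ i) ∧ wordProd l = a}

/-- The span of all reduced words. -/
def wordSpan (φ : A →ₗ[ℂ] ℂ) (𝒜 : I → Subalgebra ℂ A) : Submodule ℂ A :=
  Submodule.span ℂ {a | ∃ l, IsReducedWord φ 𝒜 l ∧ wordProd l = a}

variable {φ : A →ₗ[ℂ] ℂ} {𝒜 : I → Subalgebra ℂ A}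

lemma IsFreeFamily.map_wordProd (h : IsFreeFamily φ 𝒜) {l : List (I × A)}
    (hl : IsReducedWord φ 𝒜 l) (hne : l ≠ []) : φ (wordProd l) = 0 := by
  obtain ⟨k, hk⟩ : ∃ k, l.length = k + 1 :=
    Nat.exists_eq_succ_of_ne_zero fun h0 => hne (List.length_eq_zero_iff.1 h0)
  have key := h k (fun j => (l.get (Fin.cast hk.symm j)).1) (fun j => ?_)
    (fun j => (l.get (Fin.cast hk.symm j)).2) (fun j => (hl.2 _ (List.get_mem _ _)).1)
    (fun j => (hl.2 _ (List.get_mem _ _)).2)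
  · rw [wordProd]
    convert key
    refine List.ext_getElem (by simp [hk]) fun n h1 h2 => ?_
    simp [-List.ofFn_succ]
  · have := List.isChain_iff_getElem.1 hl.1 j (by omega)
    simpa using this

lemma startSpan_le_avoidSpan {i j : I} (hij : i ≠ j) : startSpan φ 𝒜 i ≤ avoidSpan φ 𝒜 j := by
  refine Submodule.span_mono ?_
  rintro a ⟨l, hl, ⟨p, hp, rfl⟩, rfl⟩
  refine ⟨l, hl, fun q hq => ?_, rfl⟩
  rwa [Option.mem_unique hq hp]

lemma startSpan_le_wordSpan (i : I) : startSpan φ 𝒜 i ≤ wordSpan φ 𝒜 :=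
  Submodule.span_mono fun _ ⟨l, hl, _, h⟩ => ⟨l, hl, h⟩

lemma avoidSpan_le_wordSpan (i : I) : avoidSpan φ 𝒜 i ≤ wordSpan φ 𝒜 :=
  Submodule.span_mono fun _ ⟨l, hl, _, h⟩ => ⟨l, hl, h⟩

lemma wordSpan_le_sup (i : I) : wordSpan φ 𝒜 ≤ startSpan φ 𝒜 i ⊔ avoidSpan φ 𝒜 i := by
  refine Submodule.span_le.2 ?_
  rintro a ⟨l, hl, rfl⟩
  by_cases h : ∃ p ∈ l.head?, p.1 = i
  · exact Submodule.mem_sup_left (Submodule.subset_span ⟨l, hl, h, rfl⟩)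
  · push Not at h
    exact Submodule.mem_sup_right (Submodule.subset_span ⟨l, hl, h, rfl⟩)

lemma one_mem_avoidSpan (i : I) : (1 : A) ∈ avoidSpan φ 𝒜 i :=
  Submodule.subset_span ⟨[], ⟨List.isChain_nil, by simp⟩, by simp, rfl⟩

lemma star_wordProd {A I : Type*} [Ring A] [StarRing A] (l : List (I × A)) :
    star (wordProd l) = wordProd (l.reverse.map fun p => (p.1, star p.2)) := by
  induction l with
  | nil => simp [wordProd]
  | cons p l ih =>
    simp only [wordProd, List.map_cons, List.prod_cons, star_mul, List.reverse_cons,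
      List.map_append, List.prod_append] at ih ⊢
    rw [ih]
    simp

lemma IsReducedWord.star_reverse_append [StarRing A] (hφ : ∀ x, φ (star x) = star (φ x))
    (h𝒜 : ∀ i, ∀ x ∈ 𝒜 i, star x ∈ 𝒜 i) {i : I} {l₁ l₂ : List (I × A)}
    (h₁ : IsReducedWord φ 𝒜 l₁) (h₂ : IsReducedWord φ 𝒜 l₂)
    (hl₁ : ∃ p ∈ l₁.head?, p.1 = i) (hl₂ : ∀ p ∈ l₂.head?, p.1 ≠ i) :
    IsReducedWord φ 𝒜 ((l₁.reverse.map fun p => (p.1, star p.2)) ++ l₂) := by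
  refine ⟨List.isChain_append.2 ⟨?_, h₂.1, ?_⟩, ?_⟩
  · rw [List.isChain_map, List.isChain_reverse]
    exact h₁.1.imp fun _ _ h => h.symm
  · obtain ⟨p, hp, rfl⟩ := hl₁
    intro x hx y hy
    rw [List.getLast?_map, List.getLast?_reverse, Option.mem_def.1 hp] at hx
    simp only [Option.map_some, Option.mem_def, Option.some.injEq] at hx
    subst hx
    exact (hl₂ y hy).symm
  · intro p hp
    rw [List.mem_append] at hp
    rcases hp with hp | hp
    · simp only [List.mem_map, List.mem_reverse] at hp
      obtain ⟨q, hq, rfl⟩ := hp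
      exact ⟨h𝒜 _ _ (h₁.2 q hq).1, by simp [hφ, (h₁.2 q hq).2]⟩
    · exact h₂.2 p hp

lemma IsFreeFamily.map_star_mul_eq_zero [StarRing A] [StarModule ℂ A] (h : IsFreeFamily φ 𝒜)
    (hφ : ∀ x, φ (star x) = star (φ x)) (h𝒜 : ∀ i, ∀ x ∈ 𝒜 i, star x ∈ 𝒜 i) {i : I} {x y : A}
    (hx : x ∈ startSpan φ 𝒜 i) (hy : y ∈ avoidSpan φ 𝒜 i) : φ (star x * y) = 0 := by
  induction hy using Submodule.span_induction with
  | zero => simp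
  | add y z _ _ h1 h2 => rw [mul_add, map_add, h1, h2, add_zero]
  | smul c y _ h1 => rw [mul_smul_comm, map_smul, h1, smul_zero]
  | mem y hy =>
    obtain ⟨l₂, h₂, hl₂, rfl⟩ := hy
    induction hx using Submodule.span_induction with
    | zero => simp
    | add y z _ _ h1 h2 => rw [star_add, add_mul, map_add, h1, h2, add_zero]
    | smul c y _ h1 => rw [star_smul, smul_mul_assoc, map_smul, h1, smul_zero]
    | mem x hx =>
      obtain ⟨l₁, h₁, hl₁, rfl⟩ := hx
      have := h.map_wordProd (h₁.star_reverse_append hφ h𝒜 h₂ hl₁ hl₂) (by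
        obtain ⟨p, hp, -⟩ := hl₁
        have : l₁ ≠ [] := by rintro rfl; simp at hp
        simp [this])
      rwa [star_wordProd, wordProd, wordProd, ← List.prod_append, ← List.map_append]

lemma mul_mem_startSpan {i : I} {z x : A} (hz : z ∈ 𝒜 i) (hz0 : φ z = 0)
    (hx : x ∈ avoidSpan φ 𝒜 i) : z * x ∈ startSpan φ 𝒜 i := by
  induction hx using Submodule.span_induction with
  | zero => simp
  | add x y _ _ h1 h2 => rw [mul_add]; exact Submodule.add_mem _ h1 h2
  | smul c x _ h1 => rw [mul_smul_comm]; exact Submodule.smul_mem _ _ h1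
  | mem x hx =>
    obtain ⟨l, hl, hli, rfl⟩ := hx
    refine Submodule.subset_span ⟨(i, z) :: l, ⟨?_, ?_⟩, ⟨(i, z), by simp, rfl⟩, by simp [wordProd]⟩
    · exact List.isChain_cons.2 ⟨fun y hy => (hli y hy).symm, hl.1⟩
    · intro p hp
      rcases List.mem_cons.1 hp with rfl | hp
      · exact ⟨hz, hz0⟩
      · exact hl.2 p hp

lemma mul_mem_wordSpan_of_avoidSpan (h1 : φ 1 = 1) {i : I} {z x : A} (hz : z ∈ 𝒜 i)
    (hx : x ∈ avoidSpan φ 𝒜 i) : z * x ∈ wordSpan φ 𝒜 := by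
  have e : z * x = (z - algebraMap ℂ A (φ z)) * x + φ z • x := by
    rw [sub_mul, Algebra.smul_def, sub_add_cancel]
  rw [e]
  refine Submodule.add_mem _ (startSpan_le_wordSpan i (mul_mem_startSpan ?_ ?_ hx))
    (Submodule.smul_mem _ _ (avoidSpan_le_wordSpan i hx))
  · exact (𝒜 i).sub_mem hz ((𝒜 i).algebraMap_mem _)
  · rw [map_sub, Algebra.algebraMap_eq_smul_one, map_smul, h1, smul_eq_mul, mul_one, sub_self]

lemma mul_mem_wordSpan (h1 : φ 1 = 1) {i : I} {z x : A} (hz : z ∈ 𝒜 i)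
    (hx : x ∈ wordSpan φ 𝒜) : z * x ∈ wordSpan φ 𝒜 := by
  obtain ⟨w, hw, n, hn, rfl⟩ := Submodule.mem_sup.1 (wordSpan_le_sup i hx)
  rw [mul_add]
  refine Submodule.add_mem _ ?_ (mul_mem_wordSpan_of_avoidSpan h1 hz hn)
  clear hx hn n
  induction hw using Submodule.span_induction with
  | zero => simp
  | add x y _ _ h1 h2 => rw [mul_add]; exact Submodule.add_mem _ h1 h2
  | smul c x _ h1 => rw [mul_smul_comm]; exact Submodule.smul_mem _ _ h1
  | mem x hx =>
    obtain ⟨l, hl, ⟨p, hp, rfl⟩, rfl⟩ := hx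
    cases l with
    | nil => simp at hp
    | cons q l =>
      obtain rfl : q = p := by simpa using hp
      have hc := List.isChain_cons.1 hl.1
      have e : z * wordProd (q :: l) = (z * q.2) * wordProd l := by
        simp [wordProd, mul_assoc]
      rw [e]
      refine mul_mem_wordSpan_of_avoidSpan h1 ((𝒜 q.1).mul_mem hz (hl.2 q (by simp)).1)
        (Submodule.subset_span ⟨l, ⟨hc.2, fun r hr => hl.2 r (by simp [hr])⟩,
          fun r hr => (hc.1 r hr).symm, rfl⟩)

end FreeWords

section GNS

open scoped InnerProductSpace ComplexOrder

variable {A : Type*} [CStarAlgebra A] [PartialOrder A] [StarOrderedRing A] (f : A →ₚ[ℂ] ℂ)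

/-- The canonical map from a C⋆-algebra to the GNS Hilbert space of a positive functional. -/
noncomputable def gnsVec : A →ₗ[ℂ] f.GNS :=
  (UniformSpace.Completion.toComplₗᵢ (𝕜 := ℂ) (E := f.PreGNS)).toLinearMap ∘ₗ
    f.toPreGNS.toLinearMap

lemma inner_gnsVec (a b : A) : ⟪gnsVec f a, gnsVec f b⟫_ℂ = f (star a * b) := by
  simp [gnsVec, PositiveLinearMap.preGNS_inner_def]

lemma gnsStarAlgHom_gnsVec (a b : A) : f.gnsStarAlgHom a (gnsVec f b) = gnsVec f (a * b) := by
  simp [gnsVec]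

lemma inner_gnsStarAlgHom {a : A} (ha : IsSelfAdjoint a) (ξ η : f.GNS) :
    ⟪f.gnsStarAlgHom a ξ, η⟫_ℂ = ⟪ξ, f.gnsStarAlgHom a η⟫_ℂ := by
  rw [← ContinuousLinearMap.adjoint_inner_right, ← ContinuousLinearMap.star_eq_adjoint, ← map_star,
    ha.star_eq]

lemma norm_gnsStarAlgHom_apply_le (a : A) (ξ : f.GNS) : ‖f.gnsStarAlgHom a ξ‖ ≤ ‖a‖ * ‖ξ‖ :=
  (ContinuousLinearMap.le_opNorm _ _).trans (mul_le_mul_of_nonneg_right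
    (NonUnitalStarAlgHom.norm_apply_le f.gnsStarAlgHom a) (norm_nonneg _))

variable {I : Type*} (𝒜 : I → Subalgebra ℂ A)

/-- The closed subspace of the GNS space spanned by the reduced words starting with `i`. -/
noncomputable def startSpace (i : I) : Submodule ℂ f.GNS :=
  ((startSpan f.toLinearMap 𝒜 i).map (gnsVec f)).topologicalClosure

instance (i : I) : CompleteSpace (startSpace f 𝒜 i) :=
  (Submodule.isClosed_topologicalClosure _).completeSpace_coe

/-- The orthogonal projection onto `startSpace f 𝒜 i`. -/
noncomputable def startProj (i : I) : f.GNS →ₗ[ℂ] f.GNS :=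
  (startSpace f 𝒜 i).starProjection.toLinearMap

variable {f 𝒜} (hfree : IsFreeFamily f.toLinearMap 𝒜) (hst : ∀ i, ∀ x ∈ 𝒜 i, star x ∈ 𝒜 i)
include hfree hst

lemma gnsVec_mem_orthogonal {i : I} {n : A} (hn : n ∈ avoidSpan f.toLinearMap 𝒜 i) :
    gnsVec f n ∈ (startSpace f 𝒜 i)ᗮ := by
  rw [startSpace, Submodule.orthogonal_closure, Submodule.mem_orthogonal]
  rintro _ ⟨w, hw, rfl⟩
  rw [inner_gnsVec]
  exact hfree.map_star_mul_eq_zero (fun x => map_star f x) hst hw hn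

lemma startProj_gnsVec_add {i : I} {w n : A} (hw : w ∈ startSpan f.toLinearMap 𝒜 i)
    (hn : n ∈ avoidSpan f.toLinearMap 𝒜 i) :
    startProj f 𝒜 i (gnsVec f (w + n)) = gnsVec f w :=
  Submodule.eq_starProjection_of_mem_orthogonal'
    (Submodule.le_topologicalClosure _ ⟨w, hw, rfl⟩) (gnsVec_mem_orthogonal hfree hst hn)
    (map_add _ _ _)

lemma startProj_gnsVec_start {i : I} {w : A} (hw : w ∈ startSpan f.toLinearMap 𝒜 i) :
    startProj f 𝒜 i (gnsVec f w) = gnsVec f w := by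
  simpa using startProj_gnsVec_add hfree hst hw (Submodule.zero_mem _)

lemma startProj_gnsVec_avoid {i : I} {n : A} (hn : n ∈ avoidSpan f.toLinearMap 𝒜 i) :
    startProj f 𝒜 i (gnsVec f n) = 0 := by
  simpa using startProj_gnsVec_add hfree hst (Submodule.zero_mem _) hn

lemma isOrtho_startSpace {i j : I} (hij : i ≠ j) : startSpace f 𝒜 i ⟂ startSpace f 𝒜 j := by
  rw [Submodule.IsOrtho, startSpace]
  refine Submodule.topologicalClosure_minimal _ ?_ (Submodule.isClosed_orthogonal _)
  rintro _ ⟨w, hw, rfl⟩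
  exact gnsVec_mem_orthogonal hfree hst (startSpan_le_avoidSpan hij hw)

lemma isCreationSystem_gns (h1 : f 1 = 1) {z : I → A} (hz : ∀ i, z i ∈ 𝒜 i)
    (hsa : ∀ i, IsSelfAdjoint (z i)) (hz0 : ∀ i, f (z i) = 0) {v : I → ℝ}
    (hv : ∀ i, f (z i ^ 2) = (v i : ℂ)) :
    IsCreationSystem (startProj f 𝒜) (fun i => (f.gnsStarAlgHom (z i)).toLinearMap) v
      ((wordSpan f.toLinearMap 𝒜).map (gnsVec f)) where
  proj_symm i ξ η := Submodule.inner_starProjection_left_eq_right _ ξ η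
  proj_idem i ξ := Submodule.starProjection_eq_self_iff.2 (Submodule.starProjection_apply_mem _ _)
  proj_orth i j hij ξ :=
    DFunLike.congr_fun (isOrtho_startSpace hfree hst hij).starProjection_comp_starProjection ξ
  symm i ξ η := inner_gnsStarAlgHom f (hsa i) ξ η
  proj_mem i := by
    rintro _ ⟨x, hx, rfl⟩
    obtain ⟨w, hw, n, hn, rfl⟩ := Submodule.mem_sup.1 (wordSpan_le_sup i hx)
    rw [startProj_gnsVec_add hfree hst hw hn]
    exact ⟨w, startSpan_le_wordSpan i hw, rfl⟩
  mem i := by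
    rintro _ ⟨x, hx, rfl⟩
    exact ⟨z i * x, mul_mem_wordSpan h1 (hz i) hx, (gnsStarAlgHom_gnsVec f _ _).symm⟩
  create i := by
    rintro _ ⟨x, hx, rfl⟩
    obtain ⟨w, hw, n, hn, rfl⟩ := Submodule.mem_sup.1 (wordSpan_le_sup i hx)
    rw [startProj_gnsVec_add hfree hst hw hn, map_add, add_sub_cancel_left,
      ContinuousLinearMap.coe_coe, gnsStarAlgHom_gnsVec]
    exact startProj_gnsVec_start hfree hst (mul_mem_startSpan (hz i) (hz0 i) hn)
  compress i := by
    rintro _ ⟨x, hx, rfl⟩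
    obtain ⟨w, hw, n, hn, rfl⟩ := Submodule.mem_sup.1 (wordSpan_le_sup i hx)
    rw [startProj_gnsVec_add hfree hst hw hn, map_add, add_sub_cancel_left,
      ContinuousLinearMap.coe_coe, gnsStarAlgHom_gnsVec, gnsStarAlgHom_gnsVec]
    have hy : z i ^ 2 - algebraMap ℂ A (v i) ∈ 𝒜 i :=
      (𝒜 i).sub_mem ((𝒜 i).pow_mem (hz i) 2) ((𝒜 i).algebraMap_mem _)
    have hy0 : f.toLinearMap (z i ^ 2 - algebraMap ℂ A (v i)) = 0 := by
      rw [map_sub, Algebra.algebraMap_eq_smul_one, map_smul]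
      change f (z i ^ 2) - (v i : ℂ) • f 1 = 0
      rw [hv, h1, smul_eq_mul, mul_one, sub_self]
    have hyn := mul_mem_startSpan hy hy0 hn
    have e : z i * (z i * n) = (z i ^ 2 - algebraMap ℂ A (v i)) * n + (v i : ℂ) • n := by
      rw [sub_mul, Algebra.smul_def, sub_add_cancel, sq, mul_assoc]
    rw [e, startProj_gnsVec_add hfree hst hyn (Submodule.smul_mem _ _ hn), map_add,
      add_sub_cancel_left, map_smul]

end GNS

section States

open scoped InnerProductSpace ComplexOrder

variable {A : Type*} [CStarAlgebra A] {φ : A →ₗ[ℂ] ℂ}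

lemma norm_gnsVec_one [PartialOrder A] [StarOrderedRing A] {f : A →ₚ[ℂ] ℂ} (h1 : f 1 = 1) :
    ‖gnsVec f 1‖ = 1 := by
  have h2 : ‖gnsVec f 1‖ ^ 2 = 1 := by
    rw [← inner_self_eq_norm_sq (𝕜 := ℂ), inner_gnsVec]
    simp [h1]
  exact (pow_eq_one_iff_of_nonneg (norm_nonneg _) two_ne_zero).mp h2

namespace IsState

lemma exists_positiveLinearMap [PartialOrder A] [StarOrderedRing A] (hφ : IsState φ) :
    ∃ f : A →ₚ[ℂ] ℂ, f.toLinearMap = φ := by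
  refine ⟨PositiveLinearMap.mk₀ φ fun x hx => ?_, rfl⟩
  obtain ⟨b, rfl⟩ := CStarAlgebra.nonneg_iff_eq_star_mul_self.mp hx
  exact Complex.nonneg_iff.mpr ⟨(hφ.2 b).1, (hφ.2 b).2.symm⟩

lemma norm_apply_le (hφ : IsState φ) (x : A) : ‖φ x‖ ≤ ‖x‖ := by
  let _ := CStarAlgebra.spectralOrder A
  have := CStarAlgebra.spectralOrderedRing A
  obtain ⟨f, rfl⟩ := hφ.exists_positiveLinearMap
  have h1 : f 1 = 1 := hφ.1
  have hΩ := norm_gnsVec_one h1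
  have : f x = ⟪gnsVec f 1, f.gnsStarAlgHom x (gnsVec f 1)⟫_ℂ := by
    rw [gnsStarAlgHom_gnsVec, inner_gnsVec]; simp
  calc ‖f x‖ ≤ ‖gnsVec f 1‖ * ‖f.gnsStarAlgHom x (gnsVec f 1)‖ := by
        rw [this]; exact norm_inner_le_norm _ _
    _ ≤ ‖x‖ := by simpa [hΩ] using norm_gnsStarAlgHom_apply_le f x (gnsVec f 1)

lemma re_cfc_nonneg (hφ : IsState φ) {x : A} {g : ℝ → ℝ}
    (hg : Continuous g) (h0 : ∀ t ∈ spectrum ℝ x, 0 ≤ g t) :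
    0 ≤ (φ (cfc g x)).re := by
  have : cfc g x = star (cfc (fun t => √(g t)) x) * cfc (fun t => √(g t)) x := by
    rw [(cfc_predicate (fun t => √(g t)) x : IsSelfAdjoint _).star_eq,
      ← cfc_mul _ _ x (by fun_prop) (by fun_prop)]
    exact cfc_congr fun t ht => (Real.mul_self_sqrt (h0 t ht)).symm
  rw [this]
  exact (hφ.2 _).1

lemma nontrivial (hφ : IsState φ) : Nontrivial A := by
  refine ⟨1, 0, fun h => ?_⟩
  have := hφ.1
  rw [h, map_zero] at this
  exact zero_ne_one this

/-- A faithful state recovers the norm of a self-adjoint element from the growth of its even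
moments. -/
lemma norm_le_of_moments (hφ : IsState φ) (hFa : IsFaithful φ) {x : A}
    (hx : IsSelfAdjoint x) {C : ℝ} (hC : 0 ≤ C)
    (hmom : ∀ k : ℕ, (φ (x ^ (2 * k))).re ≤ C ^ (2 * k)) : ‖x‖ ≤ C := by
  by_contra! hlt
  have := hφ.nontrivial
  obtain ⟨D, hCD, hDx⟩ := exists_between hlt
  have hD : 0 < D := hC.trans_lt hCD
  set g : ℝ → ℝ := fun t => max 0 (|t| - D) with hg
  have hgc : Continuous g := by fun_prop
  set y := cfc g x with hy
  have hspec : ∀ t ∈ spectrum ℝ x, |t| ≤ ‖x‖ := fun t ht => spectrum.norm_le_norm_of_mem ht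
  have hysa : IsSelfAdjoint y := cfc_predicate g x
  have hbd : ∀ k : ℕ, (φ (star y * y)).re ≤ ‖x‖ ^ 2 * ((C / D) ^ 2) ^ k := by
    intro k
    have e1 : star y * y = cfc (fun t => g t * g t) x := by
      rw [hysa.star_eq, hy, ← cfc_mul _ _ x (by fun_prop) (by fun_prop)]
    have e2 : ((‖x‖ ^ 2 * (D⁻¹) ^ (2 * k) : ℝ) : ℂ) • x ^ (2 * k) =
        cfc (fun t : ℝ => (‖x‖ ^ 2 * (D⁻¹) ^ (2 * k)) • t ^ (2 * k)) x := by
      rw [cfc_smul _ _ x (by fun_prop), cfc_pow_id x, Complex.coe_smul]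
    have e3 := hφ.re_cfc_nonneg (x := x)
      (g := fun t => (‖x‖ ^ 2 * (D⁻¹) ^ (2 * k)) • t ^ (2 * k) - g t * g t) (by fun_prop) ?_
    · rw [cfc_sub _ _ x (by fun_prop) (by fun_prop), ← e1, ← e2, map_sub, map_smul, smul_eq_mul,
        Complex.sub_re, Complex.re_ofReal_mul] at e3
      have h3 := mul_le_mul_of_nonneg_left (hmom k)
        (by positivity : 0 ≤ ‖x‖ ^ 2 * (D⁻¹) ^ (2 * k))
      calc _ ≤ ‖x‖ ^ 2 * D⁻¹ ^ (2 * k) * C ^ (2 * k) := by linarith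
        _ = _ := by rw [← pow_mul, div_eq_mul_inv, mul_pow]; ring
    · intro t ht
      simp only [hg, smul_eq_mul]
      rcases le_total |t| D with h | h
      · rw [max_eq_left (by linarith)]
        have : 0 ≤ t ^ (2 * k) := by rw [pow_mul]; positivity
        nlinarith [mul_nonneg (by positivity : 0 ≤ ‖x‖ ^ 2 * (D⁻¹) ^ (2 * k)) this]
      · rw [max_eq_right (by linarith)]
        have h1 : 1 ≤ (D⁻¹) ^ (2 * k) * t ^ (2 * k) := by
          rw [← mul_pow, pow_mul]
          refine one_le_pow₀ ?_
          rw [← sq_abs, abs_mul, abs_of_pos (inv_pos.mpr hD)]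
          refine one_le_pow₀ ?_
          rw [inv_mul_eq_div]
          exact (one_le_div hD).mpr h
        have h2 : (|t| - D) * (|t| - D) ≤ ‖x‖ ^ 2 := by
          nlinarith [hspec t ht, norm_nonneg x]
        nlinarith [sq_nonneg ‖x‖]
  have hlim : Tendsto (fun k : ℕ => ‖x‖ ^ 2 * ((C / D) ^ 2) ^ k) atTop (𝓝 (‖x‖ ^ 2 * 0)) :=
    (tendsto_pow_atTop_nhds_zero_of_lt_one (by positivity)
      (pow_lt_one₀ (by positivity) ((div_lt_one hD).mpr hCD) two_ne_zero)).const_mul _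
  have hle : (φ (star y * y)).re ≤ ‖x‖ ^ 2 * 0 := ge_of_tendsto' hlim hbd
  have hy0 : y = 0 := hFa y (Complex.ext (le_antisymm (by simpa using hle) (hφ.2 y).1) (hφ.2 y).2)
  have key : ∀ t ∈ spectrum ℝ x, |t| = ‖x‖ → False := fun t ht h => by
    have h1 := norm_apply_le_norm_cfc g x ht
    rw [← hy, hy0, norm_zero, hg] at h1
    have h2 : g t ≤ 0 := (le_abs_self _).trans h1
    have h3 : |t| - D ≤ g t := le_max_right _ _
    linarith
  rcases CStarAlgebra.norm_or_neg_norm_mem_spectrum hx with h | h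
  · exact key _ h (abs_of_nonneg (norm_nonneg _))
  · exact key _ h (by rw [abs_neg, abs_of_nonneg (norm_nonneg _)])

end IsState

variable {I : Type*} {𝒜 : I → Subalgebra ℂ A} {z : I → A} {v : I → ℝ}

/-- The GNS representation as an algebra homomorphism into plain linear endomorphisms. -/
noncomputable def gnsEnd [PartialOrder A] [StarOrderedRing A] (f : A →ₚ[ℂ] ℂ) :
    A →ₐ[ℂ] Module.End ℂ f.GNS where
  toFun a := (f.gnsStarAlgHom a).toLinearMap
  map_one' := by simp
  map_mul' a b := by simp
  map_zero' := by simp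
  map_add' a b := by simp
  commutes' r := by ext; simp [Algebra.algebraMap_eq_smul_one]

lemma apply_eq_inner_gnsEnd [PartialOrder A] [StarOrderedRing A] (f : A →ₚ[ℂ] ℂ) (x : A) :
    f x = ⟪gnsVec f 1, gnsEnd f x (gnsVec f 1)⟫_ℂ := by
  change _ = ⟪_, f.gnsStarAlgHom x (gnsVec f 1)⟫_ℂ
  rw [gnsStarAlgHom_gnsVec, inner_gnsVec]; simp

lemma gnsVec_one_mem [PartialOrder A] [StarOrderedRing A] (f : A →ₚ[ℂ] ℂ) (i : I) :
    gnsVec f 1 ∈ (wordSpan f.toLinearMap 𝒜).map (gnsVec f) :=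
  ⟨1, avoidSpan_le_wordSpan _ (one_mem_avoidSpan i), rfl⟩

theorem norm_map_aeval_S_le (hφ : IsState φ) (hfree : IsFreeFamily φ 𝒜)
    (hst : ∀ i, ∀ x ∈ 𝒜 i, star x ∈ 𝒜 i) (hz : ∀ i, z i ∈ 𝒜 i) (hsa : ∀ i, IsSelfAdjoint (z i))
    (hz0 : ∀ i, φ (z i) = 0) (hv : ∀ i, φ (z i ^ 2) = (v i : ℂ)) {F : Finset I}
    (hv0 : ∀ i, 0 ≤ v i) (hv1 : ∑ i ∈ F, v i = 1) {M : ℝ} (hM : 0 ≤ M) (hM1 : M ≤ 1)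
    (hzM : ∀ i ∈ F, ‖z i‖ ≤ M) (hvM : ∀ i ∈ F, v i ≤ M) {m : ℕ} (hm : m ≠ 0) :
    ‖φ (Polynomial.aeval (∑ i ∈ F, z i) (Polynomial.Chebyshev.S ℂ m))‖ ≤ 4 ^ m * M := by
  let _ := CStarAlgebra.spectralOrder A
  have := CStarAlgebra.spectralOrderedRing A
  obtain ⟨f, rfl⟩ := hφ.exists_positiveLinearMap
  obtain ⟨i₀, -⟩ : F.Nonempty := by
    rw [Finset.nonempty_iff_ne_empty]; rintro rfl; simp at hv1
  have hcs := isCreationSystem_gns hfree hst hφ.1 hz hsa hz0 hv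
  have := hcs.norm_inner_aeval_S_le F hv0 hv1 hM hM1
    (fun i hi ξ => (norm_gnsStarAlgHom_apply_le f _ ξ).trans
      (mul_le_mul_of_nonneg_right (hzM i hi) (norm_nonneg _)))
    (fun i hi => by rw [abs_of_nonneg (hv0 i)]; exact hvM i hi) (gnsVec_one_mem f i₀)
    (fun i => startProj_gnsVec_avoid hfree hst (one_mem_avoidSpan i)) (norm_gnsVec_one hφ.1) hm
  have e : (∑ i ∈ F, (f.gnsStarAlgHom (z i)).toLinearMap : Module.End ℂ f.GNS) =
      gnsEnd f (∑ i ∈ F, z i) := by rw [map_sum]; rfl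
  rw [e, Polynomial.aeval_algHom_apply] at this
  change ‖f _‖ ≤ _
  rwa [apply_eq_inner_gnsEnd]

theorem norm_sum_le_of_isFreeFamily (hφ : IsState φ) (hFa : IsFaithful φ)
    (hfree : IsFreeFamily φ 𝒜)
    (hst : ∀ i, ∀ x ∈ 𝒜 i, star x ∈ 𝒜 i) (hz : ∀ i, z i ∈ 𝒜 i) (hsa : ∀ i, IsSelfAdjoint (z i))
    (hz0 : ∀ i, φ (z i) = 0) (hv : ∀ i, φ (z i ^ 2) = (v i : ℂ)) {F : Finset I}
    (hv0 : ∀ i, 0 ≤ v i) {M : ℝ} (hM : 0 ≤ M) (hzM : ∀ i ∈ F, ‖z i‖ ≤ M) :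
    ‖∑ i ∈ F, z i‖ ≤ M + 2 * √(∑ i ∈ F, v i) := by
  let _ := CStarAlgebra.spectralOrder A
  have := CStarAlgebra.spectralOrderedRing A
  obtain ⟨f, rfl⟩ := hφ.exists_positiveLinearMap
  rcases F.eq_empty_or_nonempty with rfl | ⟨i₀, -⟩
  · simpa using hM
  have hcs := isCreationSystem_gns hfree hst hφ.1 hz hsa hz0 hv
  set C := M + 2 * √(∑ i ∈ F, v i) with hC
  have hC0 : 0 ≤ C := by positivity
  set T := ∑ i ∈ F, z i with hT
  have hTsa : IsSelfAdjoint T := by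
    rw [isSelfAdjoint_iff, hT, star_sum]
    exact Finset.sum_congr rfl fun i _ => (hsa i).star_eq
  set E := (wordSpan f.toLinearMap 𝒜).map (gnsVec f)
  have e : (∑ i ∈ F, (f.gnsStarAlgHom (z i)).toLinearMap : Module.End ℂ f.GNS) =
      gnsEnd f T := by rw [hT, map_sum]; rfl
  have step : ∀ k : ℕ, gnsVec f (T ^ k) ∈ E ∧ ‖gnsVec f (T ^ k)‖ ≤ C ^ k := by
    intro k
    induction k with
    | zero => simpa using ⟨gnsVec_one_mem f i₀, (norm_gnsVec_one hφ.1).le⟩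
    | succ k ih =>
      have e1 : gnsVec f (T ^ (k + 1)) = ∑ i ∈ F, (f.gnsStarAlgHom (z i)).toLinearMap
          (gnsVec f (T ^ k)) := by
        rw [← LinearMap.sum_apply]
        erw [e]
        rw [pow_succ']
        exact (gnsStarAlgHom_gnsVec f _ _).symm
      refine ⟨?_, ?_⟩
      · rw [e1]
        have := hcs.sum_mem F ih.1
        simpa using this
      · have := hcs.norm_sum_le F hv0 hM
          (fun i hi ξ => (norm_gnsStarAlgHom_apply_le f _ ξ).trans
            (mul_le_mul_of_nonneg_right (hzM i hi) (norm_nonneg _))) ih.1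
        rw [e1, pow_succ']
        exact this.trans (mul_le_mul_of_nonneg_left ih.2 hC0)
  refine hφ.norm_le_of_moments hFa hTsa hC0 fun k => ?_
  have e2 := inner_gnsVec f (T ^ k) (T ^ k)
  rw [inner_self_eq_norm_sq_to_K, star_pow, hTsa.star_eq, ← pow_add, ← two_mul] at e2
  change (f (T ^ (2 * k))).re ≤ _
  rw [← e2, mul_comm 2 k, pow_mul]
  have : ((‖gnsVec f (T ^ k)‖ : ℂ) ^ 2).re = ‖gnsVec f (T ^ k)‖ ^ 2 := by
    rw [← Complex.ofReal_pow, Complex.ofReal_re]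
  exact this.trans_le (pow_le_pow_left₀ (norm_nonneg _) (step k).2 2)

end States

section Semicircle

open Polynomial

lemma measurable_semicircleDensity : Measurable fun t : ℝ =>
    ENNReal.ofReal (Set.indicator (Set.Icc (-2 : ℝ) 2)
      (fun t => (2 * Real.pi)⁻¹ * Real.sqrt (4 - t ^ 2)) t) :=
  ((Measurable.indicator (by fun_prop) measurableSet_Icc)).ennreal_ofReal

lemma integral_semicircleLaw (g : ℝ → ℝ) :
    ∫ t, g t ∂semicircleLaw =
      ∫ t in (-2 : ℝ)..2, (2 * Real.pi)⁻¹ * √(4 - t ^ 2) * g t := by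
  rw [semicircleLaw, integral_withDensity_eq_integral_toReal_smul measurable_semicircleDensity
    (by simp), intervalIntegral.integral_of_le (by norm_num), ← integral_Icc_eq_integral_Ioc,
    ← integral_indicator measurableSet_Icc]
  refine integral_congr_ae (.of_forall fun t => ?_)
  by_cases ht : t ∈ Set.Icc (-2 : ℝ) 2
  · simp only [Set.indicator_of_mem ht, smul_eq_mul]
    rw [ENNReal.toReal_ofReal (by positivity)]
  · simp [Set.indicator_of_notMem ht]

lemma integral_sin_mul_sin_add_one {m : ℕ} (hm : m ≠ 0) :
    ∫ θ in (0 : ℝ)..Real.pi, Real.sin θ * Real.sin ((m + 1) * θ) = 0 := by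
  have hm' : (m : ℝ) ≠ 0 := by exact_mod_cast hm
  have hm2 : (m : ℝ) + 2 ≠ 0 := by positivity
  have hd : ∀ θ ∈ Set.uIcc (0 : ℝ) Real.pi, HasDerivAt
      (fun θ => (Real.sin (m * θ) / m - Real.sin ((m + 2) * θ) / (m + 2)) / 2)
      (Real.sin θ * Real.sin ((m + 1) * θ)) θ := by
    intro θ _
    have h1 : HasDerivAt (fun θ => Real.sin (m * θ)) (Real.cos (m * θ) * (m * 1)) θ :=
      ((hasDerivAt_id θ).const_mul (m : ℝ)).sin
    have h2 : HasDerivAt (fun θ => Real.sin ((m + 2) * θ))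
        (Real.cos ((m + 2) * θ) * (((m : ℝ) + 2) * 1)) θ :=
      ((hasDerivAt_id θ).const_mul ((m : ℝ) + 2)).sin
    refine (((h1.div_const (m : ℝ)).sub (h2.div_const ((m : ℝ) + 2))).div_const 2).congr_deriv ?_
    have e1 : (m : ℝ) * θ = (m + 1) * θ - θ := by ring
    have e2 : ((m : ℝ) + 2) * θ = (m + 1) * θ + θ := by ring
    rw [e1, e2, Real.cos_add, Real.cos_sub]
    field_simp
    ring
  rw [intervalIntegral.integral_eq_sub_of_hasDerivAt hd
    (Continuous.intervalIntegrable (by fun_prop) _ _)]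
  have : Real.sin ((m + 2 : ℝ) * Real.pi) = 0 := by
    exact_mod_cast Real.sin_nat_mul_pi (m + 2)
  simp [this]

lemma integral_S_semicircleLaw {m : ℕ} (hm : m ≠ 0) :
    ∫ t, (Chebyshev.S ℝ m).eval t ∂semicircleLaw = 0 := by
  rw [integral_semicircleLaw]
  set g : ℝ → ℝ := fun t => (2 * Real.pi)⁻¹ * √(4 - t ^ 2) * (Chebyshev.S ℝ m).eval t with hg
  have hgc : Continuous g := by
    have := (Chebyshev.S ℝ m).continuous
    fun_prop
  have hsub := intervalIntegral.integral_comp_mul_deriv (a := Real.pi) (b := 0)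
    (f := fun θ => 2 * Real.cos θ) (f' := fun θ => 2 * -Real.sin θ) (g := g)
    (fun θ _ => (Real.hasDerivAt_cos θ).const_mul 2) (by fun_prop) hgc
  simp only [Real.cos_pi, Real.cos_zero, mul_one] at hsub
  rw [mul_neg, mul_one] at hsub
  rw [← hsub, intervalIntegral.integral_symm, neg_eq_zero]
  have : ∀ θ ∈ Set.uIcc (0 : ℝ) Real.pi,
      (g ∘ fun θ => 2 * Real.cos θ) θ * (2 * -Real.sin θ) =
        -(2 / Real.pi) * (Real.sin θ * Real.sin ((m + 1) * θ)) := by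
    intro θ hθ
    rw [Set.uIcc_of_le Real.pi_pos.le] at hθ
    have h0 : 0 ≤ Real.sin θ := Real.sin_nonneg_of_mem_Icc hθ
    have h1 : √(4 - (2 * Real.cos θ) ^ 2) = 2 * Real.sin θ := by
      rw [show 4 - (2 * Real.cos θ) ^ 2 = (2 * Real.sin θ) ^ 2 by
        nlinarith [Real.sin_sq_add_cos_sq θ], Real.sqrt_sq (by positivity)]
    have h2 := Chebyshev.S_two_mul_real_cos θ m
    simp only [hg, Function.comp, h1]
    push_cast at h2
    rw [← h2]
    have := Real.pi_ne_zero
    field_simp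
  rw [intervalIntegral.integral_congr this, intervalIntegral.integral_const_mul,
    integral_sin_mul_sin_add_one hm, mul_zero]

lemma ae_mem_Icc_semicircleLaw : ∀ᵐ t ∂semicircleLaw, t ∈ Set.Icc (-2 : ℝ) 2 := by
  rw [ae_iff, semicircleLaw, withDensity_apply_eq_zero measurable_semicircleDensity]
  convert measure_empty (μ := (volume : Measure ℝ))
  ext t
  simp only [Set.mem_inter_iff, Set.mem_ofPred_eq, Set.mem_empty_iff_false, iff_false, not_and,
    not_not]
  intro h
  by_contra ht
  exact h (by simp [Set.indicator_of_notMem ht])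

lemma semicircleLaw_pos {U : Set ℝ} (hU : IsOpen U) {t₀ : ℝ} (ht₀ : t₀ ∈ Set.Icc (-2 : ℝ) 2)
    (htU : t₀ ∈ U) : 0 < semicircleLaw U := by
  rw [pos_iff_ne_zero]
  intro h
  rw [semicircleLaw, withDensity_apply_eq_zero measurable_semicircleDensity] at h
  have hcl : t₀ ∈ closure (Set.Ioo (-2 : ℝ) 2) := by
    rwa [closure_Ioo (by norm_num)]
  have hne : (U ∩ Set.Ioo (-2 : ℝ) 2).Nonempty := mem_closure_iff.mp hcl U hU htU
  refine ((hU.inter isOpen_Ioo).measure_pos volume hne).ne' (measure_mono_null ?_ h)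
  rintro t ⟨htU, ht⟩
  refine ⟨?_, htU⟩
  have hpos : 0 < 4 - t ^ 2 := by nlinarith [ht.1, ht.2]
  simp only [Set.mem_ofPred_eq, Set.indicator_of_mem (Set.Ioo_subset_Icc_self ht), ne_eq,
    ENNReal.ofReal_eq_zero, not_le]
  have := Real.pi_pos
  positivity

section Integrals

variable [IsProbabilityMeasure semicircleLaw]

lemma integrable_semicircleLaw {E : Type*} [NormedAddCommGroup E] {g : ℝ → E}
    (hg : Continuous g) : Integrable g semicircleLaw := by
  obtain ⟨C, hC⟩ := isCompact_Icc.exists_bound_of_continuousOn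
    (s := Set.Icc (-2 : ℝ) 2) hg.continuousOn
  exact Integrable.of_bound hg.aestronglyMeasurable C
    (ae_mem_Icc_semicircleLaw.mono fun t ht => hC t ht)

lemma le_of_integral_pow_semicircleLaw_le {g : ℝ → ℝ} (hg : Continuous g) (hg0 : ∀ t, 0 ≤ g t)
    {N : ℝ} (hN : 0 ≤ N) (h : ∀ k : ℕ, ∫ t, g t ^ k ∂semicircleLaw ≤ N ^ k) {t₀ : ℝ}
    (ht₀ : t₀ ∈ Set.Icc (-2 : ℝ) 2) : g t₀ ≤ N := by
  by_contra! hlt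
  obtain ⟨c, hNc, hct⟩ := exists_between hlt
  have hc : 0 < c := hN.trans_lt hNc
  have hU : IsOpen {t | c < g t} := isOpen_lt continuous_const hg
  have hpos : 0 < semicircleLaw.real {t | c < g t} :=
    ENNReal.toReal_pos (semicircleLaw_pos hU ht₀ hct).ne' (measure_ne_top _ _)
  have hle : ∀ k : ℕ, semicircleLaw.real {t | c < g t} ≤ (N / c) ^ k := by
    intro k
    have h1 : c ^ k * semicircleLaw.real {t | c < g t} ≤ ∫ t, g t ^ k ∂semicircleLaw := by
      calc _ = ∫ t in {t | c < g t}, c ^ k ∂semicircleLaw := by simp [mul_comm]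
        _ ≤ ∫ t in {t | c < g t}, g t ^ k ∂semicircleLaw :=
          setIntegral_mono_on (integrable_const _).integrableOn
            (integrable_semicircleLaw (hg.pow k)).integrableOn hU.measurableSet
            fun t ht => pow_le_pow_left₀ hc.le (le_of_lt ht) k
        _ ≤ _ := setIntegral_le_integral (integrable_semicircleLaw (hg.pow k))
            (.of_forall fun t => pow_nonneg (hg0 t) k)
    rw [div_pow, le_div_iff₀ (by positivity), mul_comm]
    exact h1.trans (h k)
  have hlim := tendsto_pow_atTop_nhds_zero_of_lt_one (by positivity) ((div_lt_one hc).mpr hNc)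
  exact absurd (ge_of_tendsto' hlim hle) (not_le.mpr hpos)

end Integrals

variable {A : Type*} [CStarAlgebra A] {ψ : A →ₗ[ℂ] ℂ} {s : A}

lemma star_aeval_of_isSelfAdjoint {x : A} (hx : IsSelfAdjoint x) (p : ℂ[X]) :
    star (aeval x p) = aeval x (p.map (starRingEnd ℂ)) := by
  induction p using Polynomial.induction_on' with
  | add p q hp hq => simp only [map_add, star_add, Polynomial.map_add, hp, hq]
  | monomial n a =>
    simp only [aeval_monomial, Polynomial.map_monomial, star_mul, star_pow, hx.star_eq]
    rw [← Algebra.smul_def, ← algebraMap_star_comm, ← Algebra.commutes, ← Algebra.smul_def]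
    rfl

namespace IsStdSemicircular

lemma isProbabilityMeasure (hs : IsStdSemicircular ψ s) (hψ : IsState ψ) :
    IsProbabilityMeasure semicircleLaw := by
  have h := hs.2 0
  simp only [pow_zero, hψ.1, integral_const, smul_eq_mul, mul_one] at h
  have h1 : semicircleLaw.real Set.univ = 1 := by exact_mod_cast h.symm
  exact ⟨(ENNReal.toReal_eq_one_iff _).mp h1⟩

lemma map_aeval (hs : IsStdSemicircular ψ s) (hψ : IsState ψ) (p : ℂ[X]) :
    ψ (aeval s p) = ∫ t, p.eval (t : ℂ) ∂semicircleLaw := by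
  have := hs.isProbabilityMeasure hψ
  induction p using Polynomial.induction_on' with
  | add p q hp hq =>
    have hc : ∀ p : ℂ[X], Continuous fun t : ℝ => p.eval (t : ℂ) := fun p =>
      p.continuous.comp Complex.continuous_ofReal
    simp only [map_add, eval_add, hp, hq]
    rw [integral_add (integrable_semicircleLaw (hc p)) (integrable_semicircleLaw (hc q))]
  | monomial n a =>
    simp only [aeval_monomial, eval_monomial]
    rw [integral_const_mul, ← Algebra.smul_def, map_smul, hs.2 n, smul_eq_mul]
    congr 1
    rw [← integral_complex_ofReal]
    simp

lemma map_aeval_S (hs : IsStdSemicircular ψ s) (hψ : IsState ψ) {m : ℕ} (hm : m ≠ 0) :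
    ψ (aeval s (Chebyshev.S ℂ m)) = 0 := by
  rw [hs.map_aeval hψ]
  simp_rw [← Chebyshev.complex_ofReal_eval_S]
  rw [integral_complex_ofReal, integral_S_semicircleLaw hm, Complex.ofReal_zero]

lemma norm_eval_le (hs : IsStdSemicircular ψ s) (hψ : IsState ψ) (p : ℂ[X]) {t₀ : ℝ}
    (ht₀ : t₀ ∈ Set.Icc (-2 : ℝ) 2) : ‖p.eval (t₀ : ℂ)‖ ≤ ‖aeval s p‖ := by
  have := hs.isProbabilityMeasure hψ
  have hc : Continuous fun t : ℝ => p.eval (t : ℂ) := p.continuous.comp Complex.continuous_ofReal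
  have heval : ∀ t : ℝ, (p.map (starRingEnd ℂ) * p).eval (t : ℂ) =
      ((‖p.eval (t : ℂ)‖ ^ 2 : ℝ) : ℂ) := by
    intro t
    rw [eval_mul, eval_map, ← Complex.conj_ofReal, eval₂_hom, Complex.conj_ofReal,
      ← Complex.normSq_eq_conj_mul_self, Complex.normSq_eq_norm_sq]
  refine le_of_sq_le_sq ?_ (norm_nonneg _)
  refine le_of_integral_pow_semicircleLaw_le (g := fun t => ‖p.eval (t : ℂ)‖ ^ 2) (by fun_prop)
    (fun t => by positivity) (by positivity) (fun k => ?_) ht₀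
  have h1 : ((∫ t, (‖p.eval ((t : ℝ) : ℂ)‖ ^ 2) ^ k ∂semicircleLaw : ℝ) : ℂ) =
      ψ ((star (aeval s p) * aeval s p) ^ k) := by
    rw [star_aeval_of_isSelfAdjoint hs.1, ← map_mul, ← map_pow, hs.map_aeval hψ,
      ← integral_complex_ofReal]
    simp only [eval_pow, heval]
    push_cast
    rfl
  have h2 : ∫ t, (‖p.eval ((t : ℝ) : ℂ)‖ ^ 2) ^ k ∂semicircleLaw =
      (ψ ((star (aeval s p) * aeval s p) ^ k)).re := by rw [← h1, Complex.ofReal_re]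
  rw [h2]
  have := hψ.nontrivial
  calc _ ≤ ‖ψ ((star (aeval s p) * aeval s p) ^ k)‖ := Complex.re_le_norm _
    _ ≤ ‖(star (aeval s p) * aeval s p) ^ k‖ := hψ.norm_apply_le _
    _ ≤ ‖star (aeval s p) * aeval s p‖ ^ k := norm_pow_le _ _
    _ = _ := by rw [CStarRing.norm_star_mul_self, sq]

end IsStdSemicircular

end Semicircle

section StrongConvergence

open Polynomial

variable {A B : Type*} [CStarAlgebra A] [CStarAlgebra B] {φ : A →ₗ[ℂ] ℂ} {ψ : B →ₗ[ℂ] ℂ}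
  {s : B} {T : ℕ → A}

lemma tendsto_map_aeval_semicircular (hφ : IsState φ) (hψ : IsState ψ)
    (hs : IsStdSemicircular ψ s)
    (hT : ∀ m : ℕ, m ≠ 0 → Tendsto (fun n => φ (aeval (T n) (Chebyshev.S ℂ m))) atTop (𝓝 0))
    (p : ℂ[X]) : Tendsto (fun n => φ (aeval (T n) p)) atTop (𝓝 (ψ (aeval s p))) := by
  have hS : ∀ k m : ℕ, Tendsto (fun n => φ (aeval (T n) (X ^ k * Chebyshev.S ℂ m))) atTop
      (𝓝 (ψ (aeval s (X ^ k * Chebyshev.S ℂ m)))) := by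
    intro k
    induction k with
    | zero =>
      intro m
      simp only [pow_zero, one_mul]
      rcases eq_or_ne m 0 with rfl | hm
      · simp [hφ.1, hψ.1]
      · rw [hs.map_aeval_S hψ hm]
        exact hT m hm
    | succ k ih =>
      intro m
      rcases m with _ | j
      · have : (X ^ (k + 1) * Chebyshev.S ℂ ((0 : ℕ) : ℤ) : ℂ[X]) =
            X ^ k * Chebyshev.S ℂ ((1 : ℕ) : ℤ) := by simp [pow_succ]
        rw [this]
        exact ih 1
      · have : (X ^ (k + 1) * Chebyshev.S ℂ ((j + 1 : ℕ) : ℤ) : ℂ[X]) =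
            X ^ k * Chebyshev.S ℂ ((j + 2 : ℕ) : ℤ) + X ^ k * Chebyshev.S ℂ ((j : ℕ) : ℤ) := by
          push_cast
          rw [Chebyshev.S_add_two]
          ring
        rw [this]
        simp only [map_add]
        exact (ih (j + 2)).add (ih j)
  induction p using Polynomial.induction_on' with
  | add p q hp hq =>
    simp only [map_add]
    exact hp.add hq
  | monomial k a =>
    have := (hS k 0).const_smul a
    simp only [Nat.cast_zero, Chebyshev.S_zero, mul_one] at this
    simpa only [← smul_X_eq_monomial, map_smul] using this

lemma IsSelfAdjoint.norm_aeval_le {x : A} (hx : IsSelfAdjoint x) (p : ℂ[X]) {c : ℝ}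
    (hc : 0 ≤ c) (h : ∀ t : ℝ, |t| ≤ ‖x‖ → ‖p.eval (t : ℂ)‖ ≤ c) : ‖aeval x p‖ ≤ c := by
  rcases subsingleton_or_nontrivial A with hA | hA
  · rwa [Subsingleton.elim (aeval x p) 0, norm_zero]
  rw [← cfc_polynomial (R := ℂ) p x hx.isStarNormal]
  refine norm_cfc_le hc fun z hz => ?_
  have h1 : z = (z.re : ℂ) := hx.mem_spectrum_eq_re hz
  have h2 := spectrum.norm_le_norm_of_mem hz
  rw [h1] at h2 ⊢
  exact h _ (by simpa using h2)

lemma eventually_norm_aeval_lt (hψ : IsState ψ) (hs : IsStdSemicircular ψ s)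
    (hsa : ∀ n, IsSelfAdjoint (T n)) (hnorm : ∀ ε > 0, ∀ᶠ n in atTop, ‖T n‖ ≤ 2 + ε)
    (p : ℂ[X]) {b : ℝ} (hb : ‖aeval s p‖ < b) : ∀ᶠ n in atTop, ‖aeval (T n) p‖ < b := by
  obtain ⟨c, hc1, hcb⟩ := exists_between hb
  have hcont : Continuous fun t : ℝ => ‖p.eval (t : ℂ)‖ :=
    (p.continuous.comp Complex.continuous_ofReal).norm
  have huc := isCompact_Icc.uniformContinuousOn_of_continuous
    (s := Set.Icc (-3 : ℝ) 3) hcont.continuousOn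
  obtain ⟨δ, hδ, hδc⟩ := Metric.uniformContinuousOn_iff.mp huc (c - ‖aeval s p‖) (by linarith)
  filter_upwards [hnorm (min 1 (δ / 2)) (by positivity)] with n hn
  refine ((hsa n).norm_aeval_le p ((norm_nonneg _).trans hc1.le) fun t ht => ?_).trans_lt hcb
  have hm1 : min 1 (δ / 2) ≤ 1 := min_le_left _ _
  have hm2 : min 1 (δ / 2) ≤ δ / 2 := min_le_right _ _
  have ht' := abs_le.mp (ht.trans hn)
  have key : ∃ t₀ ∈ Set.Icc (-2 : ℝ) 2, |t - t₀| ≤ δ / 2 := by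
    refine ⟨max (-2) (min t 2), ⟨le_max_left _ _, max_le (by norm_num) (min_le_right _ _)⟩, ?_⟩
    rw [abs_le]
    rcases le_total t 2 with h | h
    · rw [min_eq_left h]
      rcases le_total (-2) t with h' | h'
      · rw [max_eq_right h']; constructor <;> linarith
      · rw [max_eq_left h']; constructor <;> linarith
    · rw [min_eq_right h, max_eq_right (by norm_num)]; constructor <;> linarith
  obtain ⟨t₀, ht₀, hd⟩ := key
  have h1 := hδc t ⟨by linarith [ht'.1], by linarith [ht'.2]⟩ t₀
    ⟨by linarith [ht₀.1], by linarith [ht₀.2]⟩ (by rw [Real.dist_eq]; linarith)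
  rw [Real.dist_eq] at h1
  linarith [(abs_lt.mp h1).2, hs.norm_eval_le hψ p ht₀]

lemma aeval_map_conj_mul_self {x : A} (hx : IsSelfAdjoint x) (p : ℂ[X]) :
    aeval x (p.map (starRingEnd ℂ) * p) = star (aeval x p) * aeval x p := by
  rw [star_aeval_of_isSelfAdjoint hx, ← map_mul]

lemma eventually_lt_norm_aeval (hφ : IsState φ) (hψ : IsState ψ) (hFa : IsFaithful ψ)
    (hs : IsSelfAdjoint s) (hsa : ∀ n, IsSelfAdjoint (T n))
    (hmom : ∀ p : ℂ[X], Tendsto (fun n => φ (aeval (T n) p)) atTop (𝓝 (ψ (aeval s p))))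
    (p : ℂ[X]) {a : ℝ} (ha : a < ‖aeval s p‖) : ∀ᶠ n in atTop, a < ‖aeval (T n) p‖ := by
  rcases lt_or_ge a 0 with h0 | h0
  · exact .of_forall fun n => h0.trans_le (norm_nonneg _)
  set q := p.map (starRingEnd ℂ) * p with hq
  have hex : ∃ k : ℕ, (a ^ 2) ^ (2 * k) < (ψ (aeval s q ^ (2 * k))).re := by
    by_contra! hcon
    have := hψ.norm_le_of_moments hFa (x := aeval s q)
      (by rw [hq, aeval_map_conj_mul_self hs]; exact .star_mul_self _) (by positivity) hcon
    rw [hq, aeval_map_conj_mul_self hs, CStarRing.norm_star_mul_self, ← sq] at this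
    exact absurd (le_of_sq_le_sq this h0) (not_le.mpr ha)
  obtain ⟨k, hk⟩ := hex
  have hlim := (Complex.continuous_re.tendsto _).comp (hmom (q ^ (2 * k)))
  rw [map_pow] at hlim
  have := hφ.nontrivial
  filter_upwards [hlim.eventually_const_lt hk] with n hn
  have h1 : (a ^ 2) ^ (2 * k) < (‖aeval (T n) p‖ ^ 2) ^ (2 * k) := by
    calc _ < (φ (aeval (T n) (q ^ (2 * k)))).re := hn
      _ ≤ ‖φ (aeval (T n) (q ^ (2 * k)))‖ := Complex.re_le_norm _
      _ ≤ ‖aeval (T n) (q ^ (2 * k))‖ := hφ.norm_apply_le _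
      _ ≤ ‖aeval (T n) q‖ ^ (2 * k) := by rw [map_pow]; exact norm_pow_le _ _
      _ = _ := by rw [hq, aeval_map_conj_mul_self (hsa n), CStarRing.norm_star_mul_self, sq]
  exact lt_of_pow_lt_pow_left₀ 2 (norm_nonneg _) (lt_of_pow_lt_pow_left₀ _ (by positivity) h1)

/-- Strong convergence of a single self-adjoint sequence to a semicircular element. -/
theorem tendsto_norm_aeval_semicircular (hφ : IsState φ) (hψ : IsState ψ) (hFa : IsFaithful ψ)
    (hs : IsStdSemicircular ψ s) (hsa : ∀ n, IsSelfAdjoint (T n))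
    (hnorm : ∀ ε > 0, ∀ᶠ n in atTop, ‖T n‖ ≤ 2 + ε)
    (hmom : ∀ p : ℂ[X], Tendsto (fun n => φ (aeval (T n) p)) atTop (𝓝 (ψ (aeval s p))))
    (p : ℂ[X]) : Tendsto (fun n => ‖aeval (T n) p‖) atTop (𝓝 ‖aeval s p‖) :=
  tendsto_order.mpr ⟨fun _ ha => eventually_lt_norm_aeval hφ hψ hFa hs.1 hsa hmom p ha,
    fun _ hb => eventually_norm_aeval_lt hψ hs hsa hnorm p hb⟩

lemma tendsto_mul_sub_mul {R : Type*} [NormedRing R] {a a' b b' : ℕ → R}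
    (ha : Tendsto (fun n => a n - a' n) atTop (𝓝 0))
    (hb : Tendsto (fun n => b n - b' n) atTop (𝓝 0))
    (ha' : IsBoundedUnder (· ≤ ·) atTop fun n => ‖a' n‖)
    (hb' : IsBoundedUnder (· ≤ ·) atTop fun n => ‖b' n‖) :
    Tendsto (fun n => a n * b n - a' n * b' n) atTop (𝓝 0) := by
  have h := ((ha.mul hb).add (ha.zero_mul_isBoundedUnder_le hb')).add
    (isBoundedUnder_le_mul_tendsto_zero ha' hb)
  simp only [mul_zero, add_zero] at h
  refine h.congr fun n => ?_
  noncomm_ring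

lemma aeval_lift_X_one {R : Type*} [Ring R] [Algebra ℂ R] (x : R) (P : FreeAlgebra ℂ (Fin 2)) :
    aeval x (FreeAlgebra.lift ℂ (![X, 1] : Fin 2 → ℂ[X]) P) =
      FreeAlgebra.lift ℂ (![x, 1] : Fin 2 → R) P := by
  have : (aeval x).comp (FreeAlgebra.lift ℂ (![X, 1] : Fin 2 → ℂ[X])) =
      FreeAlgebra.lift ℂ (![x, 1] : Fin 2 → R) := by
    ext i
    fin_cases i <;> simp
  exact DFunLike.congr_fun this P

lemma tendsto_lift_sub_lift {V : ℕ → A} (hV : Tendsto (fun n => V n - 1) atTop (𝓝 0))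
    (hbdd : ∀ p : ℂ[X], IsBoundedUnder (· ≤ ·) atTop fun n => ‖aeval (T n) p‖)
    (P : FreeAlgebra ℂ (Fin 2)) :
    Tendsto (fun n => FreeAlgebra.lift ℂ (![T n, V n] : Fin 2 → A) P -
      FreeAlgebra.lift ℂ (![T n, 1] : Fin 2 → A) P) atTop (𝓝 0) := by
  have hb : ∀ P : FreeAlgebra ℂ (Fin 2), IsBoundedUnder (· ≤ ·) atTop
      fun n => ‖FreeAlgebra.lift ℂ (![T n, 1] : Fin 2 → A) P‖ := fun P => by
    simpa only [aeval_lift_X_one] using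
      hbdd (FreeAlgebra.lift ℂ (![X, 1] : Fin 2 → ℂ[X]) P)
  induction P using FreeAlgebra.induction with
  | grade0 r => simp
  | grade1 i => fin_cases i <;> simp [hV]
  | mul a b ha hb' =>
    simp only [map_mul]
    exact tendsto_mul_sub_mul ha hb' (hb a) (hb b)
  | add a b ha hb' =>
    simp only [map_add]
    simpa only [add_zero, add_sub_add_comm] using ha.add hb'

lemma norm_sub_one_le_norm_sq_sub_one [PartialOrder A] [StarOrderedRing A] {V : A}
    (hV : 0 ≤ V) : ‖V - 1‖ ≤ ‖V ^ 2 - 1‖ := by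
  have hsa : IsSelfAdjoint V := .of_nonneg hV
  have e1 : V - 1 = cfc (fun t : ℝ => t - 1) V := by
    rw [cfc_sub _ _ V (by fun_prop) (by fun_prop), cfc_id' ℝ V, cfc_const_one ℝ V]
  have e2 : V ^ 2 - 1 = cfc (fun t : ℝ => t ^ 2 - 1) V := by
    rw [cfc_sub _ _ V (by fun_prop) (by fun_prop), cfc_pow_id (R := ℝ) V, cfc_const_one ℝ V]
  rw [e1]
  refine norm_cfc_le (norm_nonneg _) fun t ht => ?_
  have h0 : 0 ≤ t := spectrum_nonneg_of_nonneg hV ht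
  have h1 := norm_apply_le_norm_cfc (fun t : ℝ => t ^ 2 - 1) V ht
  rw [← e2] at h1
  refine le_trans ?_ h1
  rw [show t ^ 2 - 1 = (t - 1) * (t + 1) by ring, norm_mul]
  refine le_mul_of_one_le_right (norm_nonneg _) ?_
  rw [Real.norm_of_nonneg (by linarith)]
  linarith

lemma tendsto_inv_sqrt_sub_one [PartialOrder A] [StarOrderedRing A] [Nontrivial A]
    {V W : ℕ → A} (hV : Tendsto (fun n => V n - 1) atTop (𝓝 0))
    (hW : ∀ᶠ n in atTop, 0 ≤ W n ∧ W n ^ 2 * V n = 1) :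
    Tendsto (fun n => W n - 1) atTop (𝓝 0) := by
  have hlim : Tendsto (fun n => 2 * ‖V n - 1‖) atTop (𝓝 0) := by
    simpa using hV.norm.const_mul 2
  refine squeeze_zero_norm' ?_ hlim
  have hsmall : ∀ᶠ n in atTop, ‖V n - 1‖ < 1 / 2 := by
    have := hV.norm
    rw [norm_zero] at this
    exact this.eventually_lt_const (by norm_num)
  filter_upwards [hW, hsmall] with n ⟨h0, h1⟩ h2
  refine (norm_sub_one_le_norm_sq_sub_one h0).trans ?_
  have e : W n ^ 2 - 1 = -((W n ^ 2 - 1) * (V n - 1) + (V n - 1)) := by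
    rw [sub_mul, mul_sub, h1]; noncomm_ring
  have h3 : ‖W n ^ 2 - 1‖ ≤ ‖W n ^ 2 - 1‖ * ‖V n - 1‖ + ‖V n - 1‖ := by
    conv_lhs => rw [e, norm_neg]
    exact (norm_add_le _ _).trans (add_le_add_left (norm_mul_le _ _) _)
  nlinarith [norm_nonneg (W n ^ 2 - 1)]

end StrongConvergence

section Lyapunov

open Polynomial

variable {A : Type*} [CStarAlgebra A] {φ : A →ₗ[ℂ] ℂ}

lemma IsSelfAdjoint.star_mem_adjoin {x a : A} (hx : IsSelfAdjoint x)
    (ha : a ∈ Algebra.adjoin ℂ {x}) : star a ∈ Algebra.adjoin ℂ {x} := by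
  have := Subalgebra.star_adjoin_comm ℂ ({x} : Set A)
  rw [Set.star_singleton, hx.star_eq] at this
  rw [← Subalgebra.mem_star_iff, this]
  exact ha

lemma IsState.map_sq_of_isSelfAdjoint (hφ : IsState φ) {x : A} (hx : IsSelfAdjoint x) :
    0 ≤ (φ (x ^ 2)).re ∧ φ (x ^ 2) = ((φ (x ^ 2)).re : ℂ) ∧ (φ (x ^ 2)).re ≤ ‖x‖ ^ 2 := by
  have h := hφ.2 x
  rw [hx.star_eq, ← sq] at h
  have := hφ.nontrivial
  exact ⟨h.1, Complex.ext rfl (by simpa using h.2),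
    (Complex.re_le_norm _).trans ((hφ.norm_apply_le _).trans (norm_pow_le _ _))⟩

variable {I : Type*} {X : I → A} {v : I → ℝ} {F : Finset I} {b : ℝ}

lemma norm_le_sqrt_sqrt_mul (hb : 0 < b) {i : I} (hi : i ∈ F) :
    b⁻¹ * ‖X i‖ ≤ √√((∑ i ∈ F, ‖X i‖ ^ 4) / b ^ 4) := by
  refine Real.le_sqrt_of_sq_le (Real.le_sqrt_of_sq_le ?_)
  rw [← pow_mul, mul_pow, inv_pow, inv_mul_eq_div]
  exact div_le_div_of_nonneg_right
    (Finset.single_le_sum (f := fun i => ‖X i‖ ^ 4) (fun _ _ => by positivity) hi) (by positivity)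

variable (hφ : IsState φ) (hfree : AreFree φ X) (hsa : ∀ i, IsSelfAdjoint (X i))
  (hmean : ∀ i, φ (X i) = 0) (hvar : ∀ i, φ (X i ^ 2) = (v i : ℂ)) (hb : 0 < b)
  (hsum : ∑ i ∈ F, v i = b ^ 2)

include hsa in
lemma isSelfAdjoint_ofReal_inv_smul (b : ℝ) (i : I) : IsSelfAdjoint ((b : ℂ)⁻¹ • X i) := by
  refine IsSelfAdjoint.smul ?_ (hsa i)
  rw [isSelfAdjoint_iff]
  simp

include hvar in
lemma map_ofReal_inv_smul_sq (b : ℝ) (i : I) :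
    φ (((b : ℂ)⁻¹ • X i) ^ 2) = (((b ^ 2)⁻¹ * v i : ℝ) : ℂ) := by
  rw [_root_.smul_pow, map_smul, hvar]
  simp

include hφ hsa hvar in
lemma variance_bounds (i : I) : 0 ≤ v i ∧ v i ≤ ‖X i‖ ^ 2 := by
  have h := hφ.map_sq_of_isSelfAdjoint (hsa i)
  rw [hvar, Complex.ofReal_re] at h
  exact ⟨h.1, h.2.2⟩

include hφ hfree hsa hmean hvar hb hsum

theorem norm_map_aeval_S_normalizedSum_le (hL : (∑ i ∈ F, ‖X i‖ ^ 4) / b ^ 4 ≤ 1) {m : ℕ}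
    (hm : m ≠ 0) :
    ‖φ (aeval ((b : ℂ)⁻¹ • ∑ i ∈ F, X i) (Chebyshev.S ℂ m))‖ ≤
      4 ^ m * √√((∑ i ∈ F, ‖X i‖ ^ 4) / b ^ 4) := by
  rw [Finset.smul_sum]
  set r := √√((∑ i ∈ F, ‖X i‖ ^ 4) / b ^ 4) with hr
  have hr1 : r ≤ 1 := by
    rw [hr, Real.sqrt_le_one, Real.sqrt_le_one]
    exact hL
  have hr0 : 0 ≤ r := Real.sqrt_nonneg _
  have hX : ∀ i ∈ F, b⁻¹ * ‖X i‖ ≤ r := fun i hi => norm_le_sqrt_sqrt_mul hb hi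
  refine norm_map_aeval_S_le (𝒜 := fun i => Algebra.adjoin ℂ {X i})
    (z := fun i => (b : ℂ)⁻¹ • X i) (v := fun i => (b ^ 2)⁻¹ * v i) hφ hfree
    (fun i x hx => (hsa i).star_mem_adjoin hx)
    (fun i => Subalgebra.smul_mem _ (Algebra.self_mem_adjoin_singleton ℂ (X i)) _)
    (isSelfAdjoint_ofReal_inv_smul hsa b) (fun i => by rw [map_smul, hmean, smul_zero])
    (map_ofReal_inv_smul_sq hvar b)
    (fun i => mul_nonneg (by positivity) (variance_bounds hφ hsa hvar i).1) ?_ hr0 hr1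
    (fun i hi => ?_) (fun i hi => ?_) hm
  · rw [← Finset.mul_sum, hsum, inv_mul_cancel₀ (by positivity)]
  · rw [norm_smul, norm_inv, Complex.norm_of_nonneg hb.le]
    exact hX i hi
  · calc (b ^ 2)⁻¹ * v i ≤ (b ^ 2)⁻¹ * ‖X i‖ ^ 2 :=
        mul_le_mul_of_nonneg_left (variance_bounds hφ hsa hvar i).2 (by positivity)
      _ = (b⁻¹ * ‖X i‖) ^ 2 := by rw [mul_pow, inv_pow]
      _ ≤ r ^ 2 := pow_le_pow_left₀ (by positivity) (hX i hi) 2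
      _ ≤ r := by nlinarith

theorem norm_normalizedSum_le (hFa : IsFaithful φ) :
    ‖(b : ℂ)⁻¹ • ∑ i ∈ F, X i‖ ≤ √√((∑ i ∈ F, ‖X i‖ ^ 4) / b ^ 4) + 2 := by
  rw [Finset.smul_sum]
  have h := norm_sum_le_of_isFreeFamily (𝒜 := fun i => Algebra.adjoin ℂ {X i})
    (z := fun i => (b : ℂ)⁻¹ • X i) (v := fun i => (b ^ 2)⁻¹ * v i) (F := F)
    (M := √√((∑ i ∈ F, ‖X i‖ ^ 4) / b ^ 4)) hφ hFa hfree
    (fun i x hx => (hsa i).star_mem_adjoin hx)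
    (fun i => Subalgebra.smul_mem _ (Algebra.self_mem_adjoin_singleton ℂ (X i)) _)
    (isSelfAdjoint_ofReal_inv_smul hsa b) (fun i => by rw [map_smul, hmean, smul_zero])
    (map_ofReal_inv_smul_sq hvar b)
    (fun i => mul_nonneg (by positivity) (variance_bounds hφ hsa hvar i).1) (Real.sqrt_nonneg _)
    (fun i hi => by
      rw [norm_smul, norm_inv, Complex.norm_of_nonneg hb.le]
      exact norm_le_sqrt_sqrt_mul hb hi)
  rwa [← Finset.mul_sum, hsum, inv_mul_cancel₀ (by positivity), Real.sqrt_one, mul_one] at h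

omit hmean in
theorem norm_normalizedSumSq_sub_one_le (hFa : IsFaithful φ) :
    ‖((b ^ 2 : ℝ) : ℂ)⁻¹ • (∑ i ∈ F, X i ^ 2) - 1‖ ≤ 6 * √((∑ i ∈ F, ‖X i‖ ^ 4) / b ^ 4) := by
  set L := (∑ i ∈ F, ‖X i‖ ^ 4) / b ^ 4 with hL
  have hL0 : 0 ≤ L := by positivity
  have := hφ.nontrivial
  set y : I → A := fun i => X i ^ 2 - (v i : ℂ) • 1 with hy
  have hysa : ∀ i, IsSelfAdjoint (y i) := fun i =>
    ((hsa i).pow 2).sub (IsSelfAdjoint.smul (by rw [isSelfAdjoint_iff]; simp) (.one A))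
  set z : I → A := fun i => ((b ^ 2 : ℝ) : ℂ)⁻¹ • y i with hz
  have hzsa : ∀ i, IsSelfAdjoint (z i) := isSelfAdjoint_ofReal_inv_smul hysa (b ^ 2)
  have hzn : ∀ i, ‖z i‖ ≤ 2 * (b⁻¹ * ‖X i‖) ^ 2 := by
    intro i
    have hv := variance_bounds hφ hsa hvar i
    have h1 : ‖y i‖ ≤ 2 * ‖X i‖ ^ 2 := by
      calc ‖y i‖ ≤ ‖X i ^ 2‖ + ‖(v i : ℂ) • (1 : A)‖ := norm_sub_le _ _
        _ ≤ ‖X i‖ ^ 2 + v i := by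
          refine add_le_add (norm_pow_le _ _) ?_
          rw [norm_smul, CStarRing.norm_one, mul_one, Complex.norm_of_nonneg hv.1]
        _ ≤ _ := by linarith [hv.2]
    rw [hz]
    simp only
    rw [norm_smul, norm_inv, Complex.norm_of_nonneg (by positivity)]
    calc _ ≤ (b ^ 2)⁻¹ * (2 * ‖X i‖ ^ 2) := mul_le_mul_of_nonneg_left h1 (by positivity)
      _ = _ := by rw [mul_pow, inv_pow]; ring
  have hsumz : ((b ^ 2 : ℝ) : ℂ)⁻¹ • (∑ i ∈ F, X i ^ 2) - 1 = ∑ i ∈ F, z i := by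
    simp only [hz, hy]
    rw [← Finset.smul_sum, Finset.sum_sub_distrib, smul_sub, ← Finset.sum_smul,
      ← Complex.ofReal_sum, hsum, inv_smul_smul₀]
    exact_mod_cast (by positivity : b ^ 2 ≠ 0)
  have h := norm_sum_le_of_isFreeFamily (𝒜 := fun i => Algebra.adjoin ℂ {X i}) (z := z)
    (v := fun i => (φ (z i ^ 2)).re) (F := F)
    (M := 2 * √L) hφ hFa hfree
    (fun i x hx => (hsa i).star_mem_adjoin hx)
    (fun i => Subalgebra.smul_mem _ (sub_mem (pow_mem (Algebra.self_mem_adjoin_singleton ℂ (X i)) 2)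
      (Subalgebra.smul_mem _ (one_mem _) _)) _)
    hzsa (fun i => by simp [hz, hy, hvar, hφ.1])
    (fun i => (hφ.map_sq_of_isSelfAdjoint (hzsa i)).2.1)
    (fun i => (hφ.map_sq_of_isSelfAdjoint (hzsa i)).1) (by positivity)
    (fun i hi => by
      refine (hzn i).trans (mul_le_mul_of_nonneg_left ?_ zero_le_two)
      rw [← Real.sq_sqrt (Real.sqrt_nonneg L)]
      exact pow_le_pow_left₀ (by positivity) (norm_le_sqrt_sqrt_mul hb hi) 2)
  have hv4 : ∑ i ∈ F, (φ (z i ^ 2)).re ≤ 2 ^ 2 * L := by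
    calc ∑ i ∈ F, (φ (z i ^ 2)).re ≤ ∑ i ∈ F, 2 ^ 2 * (‖X i‖ ^ 4 / b ^ 4) := by
          refine Finset.sum_le_sum fun i _ => ?_
          calc _ ≤ ‖z i‖ ^ 2 := (hφ.map_sq_of_isSelfAdjoint (hzsa i)).2.2
            _ ≤ (2 * (b⁻¹ * ‖X i‖) ^ 2) ^ 2 := pow_le_pow_left₀ (norm_nonneg _) (hzn i) 2
            _ = _ := by field_simp
      _ = _ := by rw [← Finset.mul_sum, ← Finset.sum_div]
  have hsq : √(∑ i ∈ F, (φ (z i ^ 2)).re) ≤ 2 * √L := by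
    refine (Real.sqrt_le_sqrt hv4).trans_eq ?_
    rw [Real.sqrt_mul (by norm_num), Real.sqrt_sq (by norm_num)]
  rw [hsumz]
  linarith

end Lyapunov

section Main

variable {A B : Type*} [CStarAlgebra A] [PartialOrder A] [StarOrderedRing A] [CStarAlgebra B]

open Polynomial

theorem strong_convergence_normalizedSum (φ : A →ₗ[ℂ] ℂ) (hφ : IsState φ) (hFa : IsFaithful φ)
    (ψ : B →ₗ[ℂ] ℂ) (hψ : IsState ψ) (hFa' : IsFaithful ψ)
    (X : ℕ → A) (σ : ℕ → ℝ)
    (hsa : ∀ i, IsSelfAdjoint (X i)) (hfree : AreFree φ X)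
    (hmean : ∀ i, φ (X i) = 0) (hvar : ∀ i, φ (X i ^ 2) = ((σ i ^ 2 : ℝ) : ℂ))
    (hB : ∀ n : ℕ, 0 < n → 0 < ∑ i ∈ Finset.range n, σ i ^ 2)
    (hL4 : Tendsto (fun n => Lsn X σ 4 n) atTop (nhds 0))
    (V : ℕ → A)
    (hV : ∀ n : ℕ, 0 ≤ V n ∧
      (V n) ^ 2 = (((∑ i ∈ Finset.range n, σ i ^ 2 : ℝ) : ℂ))⁻¹ •
        (∑ i ∈ Finset.range n, X i ^ 2))
    (s : B) (hs : IsStdSemicircular ψ s) :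
    (∀ P : FreeAlgebra ℂ (Fin 2),
      Tendsto (fun n => φ ((FreeAlgebra.lift ℂ
          (![((Real.sqrt (∑ i ∈ Finset.range n, σ i ^ 2) : ℝ) : ℂ)⁻¹ •
              (∑ i ∈ Finset.range n, X i), V n] : Fin 2 → A)) P))
        atTop (nhds (ψ ((FreeAlgebra.lift ℂ (![s, 1] : Fin 2 → B)) P))) ∧
      Tendsto (fun n => ‖(FreeAlgebra.lift ℂ
          (![((Real.sqrt (∑ i ∈ Finset.range n, σ i ^ 2) : ℝ) : ℂ)⁻¹ •
              (∑ i ∈ Finset.range n, X i), V n] : Fin 2 → A)) P‖)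
        atTop (nhds ‖(FreeAlgebra.lift ℂ (![s, 1] : Fin 2 → B)) P‖)) ∧
    ∀ W : ℕ → A,
      (∀ᶠ n in atTop, 0 ≤ W n ∧ (W n) ^ 2 * V n = 1 ∧ V n * (W n) ^ 2 = 1) →
      ∀ k : ℕ,
        Tendsto (fun n => φ ((W n *
            (((Real.sqrt (∑ i ∈ Finset.range n, σ i ^ 2) : ℝ) : ℂ)⁻¹ •
              (∑ i ∈ Finset.range n, X i)) * W n) ^ k))
          atTop (nhds (ψ (s ^ k))) := by
  set b : ℕ → ℝ := fun n => √(∑ i ∈ Finset.range n, σ i ^ 2) with hb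
  set T : ℕ → A := fun n => ((b n : ℝ) : ℂ)⁻¹ • (∑ i ∈ Finset.range n, X i) with hT
  have := hφ.nontrivial
  have hpos : ∀ n, 0 < n → 0 < b n := fun n hn => Real.sqrt_pos.mpr (hB n hn)
  have hsq : ∀ n, ∑ i ∈ Finset.range n, σ i ^ 2 = b n ^ 2 := fun n =>
    (Real.sq_sqrt (Finset.sum_nonneg fun i _ => sq_nonneg _)).symm
  have hL : ∀ n, Lsn X σ 4 n = (∑ i ∈ Finset.range n, ‖X i‖ ^ 4) / b n ^ 4 := fun n => rfl
  have hsqrt : Tendsto (fun n => √(Lsn X σ 4 n)) atTop (𝓝 0) := by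
    simpa using hL4.sqrt
  have hsqrt2 : Tendsto (fun n => √√(Lsn X σ 4 n)) atTop (𝓝 0) := by
    simpa using hsqrt.sqrt
  have hTsa : ∀ n, IsSelfAdjoint (T n) := fun n =>
    isSelfAdjoint_ofReal_inv_smul (X := fun n => ∑ i ∈ Finset.range n, X i)
      (fun n => by
        rw [isSelfAdjoint_iff, star_sum]
        exact Finset.sum_congr rfl fun i _ => (hsa i).star_eq) (b n) n
  have hmom : ∀ p : ℂ[X], Tendsto (fun n => φ (aeval (T n) p)) atTop (𝓝 (ψ (aeval s p))) := by
    refine tendsto_map_aeval_semicircular hφ hψ hs fun m hm => ?_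
    refine squeeze_zero_norm' (a := fun n => 4 ^ m * √√(Lsn X σ 4 n)) ?_ ?_
    · filter_upwards [eventually_gt_atTop 0, hL4.eventually_le_const one_pos] with n hn h1
      exact norm_map_aeval_S_normalizedSum_le hφ hfree hsa hmean hvar (hpos n hn) (hsq n) h1 hm
    · simpa using hsqrt2.const_mul (4 ^ m)
  have hnorm : ∀ ε > 0, ∀ᶠ n in atTop, ‖T n‖ ≤ 2 + ε := by
    intro ε hε
    filter_upwards [eventually_gt_atTop 0, hsqrt2.eventually_le_const hε] with n hn h1
    have := norm_normalizedSum_le hφ hfree hsa hmean hvar (hpos n hn) (hsq n) hFa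
    rw [← hL] at this
    linarith
  have hconv := tendsto_norm_aeval_semicircular hφ hψ hFa' hs hTsa hnorm hmom
  have hbdd : ∀ p : ℂ[X], IsBoundedUnder (· ≤ ·) atTop fun n => ‖aeval (T n) p‖ := fun p =>
    (hconv p).isBoundedUnder_le
  have hV1 : Tendsto (fun n => V n - 1) atTop (𝓝 0) := by
    refine squeeze_zero_norm' (a := fun n => 6 * √(Lsn X σ 4 n)) ?_ ?_
    · filter_upwards [eventually_gt_atTop 0] with n hn
      refine (norm_sub_one_le_norm_sq_sub_one (hV n).1).trans ?_
      rw [(hV n).2, hsq n]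
      exact norm_normalizedSumSq_sub_one_le hφ hfree hsa hvar (hpos n hn) (hsq n) hFa
    · simpa using hsqrt.const_mul 6
  have hφ0 : ∀ {y : ℕ → A}, Tendsto y atTop (𝓝 0) → Tendsto (fun n => φ (y n)) atTop (𝓝 0) :=
    fun {y} hy => squeeze_zero_norm (fun n => hφ.norm_apply_le (y n)) (by simpa using hy.norm)
  refine ⟨fun P => ?_, fun W hW k => ?_⟩
  · have hd := tendsto_lift_sub_lift hV1 hbdd P
    simp_rw [← aeval_lift_X_one (T _), ← aeval_lift_X_one s] at hd ⊢
    constructor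
    · simpa using (hφ0 hd).add (hmom (FreeAlgebra.lift ℂ (![Polynomial.X, 1] : Fin 2 → ℂ[X]) P))
    · have h := (squeeze_zero_norm (fun n => abs_norm_sub_norm_le _ _)
        (by simpa using hd.norm)).add
        (hconv (FreeAlgebra.lift ℂ (![Polynomial.X, 1] : Fin 2 → ℂ[X]) P))
      simpa using h
  · have hW1 := tendsto_inv_sqrt_sub_one hV1 (hW.mono fun n h => ⟨h.1, h.2.1⟩)
    have hpow : ∀ k : ℕ, IsBoundedUnder (· ≤ ·) atTop fun n => ‖T n ^ k‖ := fun k => by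
      simpa using hbdd (Polynomial.X ^ k)
    have hT1 : IsBoundedUnder (· ≤ ·) atTop fun n => ‖T n‖ := by simpa using hpow 1
    have h1 : IsBoundedUnder (· ≤ ·) atTop fun _ : ℕ => ‖(1 : A)‖ := by simpa using hpow 0
    have hTT : Tendsto (fun n => T n - T n) atTop (𝓝 0) := by simp
    have hWT : Tendsto (fun n => W n * T n * W n - T n) atTop (𝓝 0) := by
      have h := tendsto_mul_sub_mul (tendsto_mul_sub_mul hW1 hTT h1 hT1) hW1
        (by simpa using hT1) h1
      simpa using h
    have hd : ∀ k : ℕ, Tendsto (fun n => (W n * T n * W n) ^ k - T n ^ k) atTop (𝓝 0) := by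
      intro k
      induction k with
      | zero => simp
      | succ k ih =>
        simp only [pow_succ]
        exact tendsto_mul_sub_mul ih hWT (hpow k) hT1
    have h := (hφ0 (hd k)).add (hmom (Polynomial.X ^ k))
    simp only [map_pow, aeval_X, zero_add, map_sub, sub_add_cancel] at h
    exact h

end Main

/-- **Remark 4.6**: under `L_{S,4n} → 0`, the pair `(S_n, V_n)` (normalized sum and positive
square root of the normalized sum of squares) converges strongly to `(s, 1)` for a standard
semicircular element `s`; in particular all moments of the self-normalized sum
`U_n = V_n^{-1/2} S_n V_n^{-1/2}` converge to the corresponding moments of `s`. -/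
theorem stmt_18 (A : Type*) [NormedRing A] [StarRing A] [CStarRing A] [NormedAlgebra ℂ A]
    [CompleteSpace A] [StarModule ℂ A] [PartialOrder A] [StarOrderedRing A]
    (A' : Type*) [NormedRing A'] [StarRing A'] [CStarRing A'] [NormedAlgebra ℂ A']
    [CompleteSpace A'] [StarModule ℂ A']
    (φ : A →ₗ[ℂ] ℂ) (hφ : IsState φ) (hTr : IsTracial φ) (hFa : IsFaithful φ)
    (ψ : A' →ₗ[ℂ] ℂ) (hψ : IsState ψ) (hTr' : IsTracial ψ) (hFa' : IsFaithful ψ)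
    (X : ℕ → A) (σ : ℕ → ℝ)
    (hsa : ∀ i, IsSelfAdjoint (X i)) (hfree : AreFree φ X)
    (hmean : ∀ i, φ (X i) = 0) (hvar : ∀ i, φ (X i ^ 2) = ((σ i ^ 2 : ℝ) : ℂ))
    (hB : ∀ n : ℕ, 0 < n → 0 < ∑ i ∈ Finset.range n, σ i ^ 2)
    (hL4 : Tendsto (fun n => Lsn X σ 4 n) atTop (nhds 0))
    (V : ℕ → A)
    (hV : ∀ n : ℕ, 0 ≤ V n ∧
      (V n) ^ 2 = (((∑ i ∈ Finset.range n, σ i ^ 2 : ℝ) : ℂ))⁻¹ •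
        (∑ i ∈ Finset.range n, X i ^ 2))
    (s : A') (hs : IsStdSemicircular ψ s) :
    (∀ P : FreeAlgebra ℂ (Fin 2),
      Tendsto (fun n => φ ((FreeAlgebra.lift ℂ
          (![((Real.sqrt (∑ i ∈ Finset.range n, σ i ^ 2) : ℝ) : ℂ)⁻¹ •
              (∑ i ∈ Finset.range n, X i), V n] : Fin 2 → A)) P))
        atTop (nhds (ψ ((FreeAlgebra.lift ℂ (![s, 1] : Fin 2 → A')) P))) ∧
      Tendsto (fun n => ‖(FreeAlgebra.lift ℂ
          (![((Real.sqrt (∑ i ∈ Finset.range n, σ i ^ 2) : ℝ) : ℂ)⁻¹ •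
              (∑ i ∈ Finset.range n, X i), V n] : Fin 2 → A)) P‖)
        atTop (nhds ‖(FreeAlgebra.lift ℂ (![s, 1] : Fin 2 → A')) P‖)) ∧
    ∀ W : ℕ → A,
      (∀ᶠ n in atTop, 0 ≤ W n ∧ (W n) ^ 2 * V n = 1 ∧ V n * (W n) ^ 2 = 1) →
      ∀ k : ℕ,
        Tendsto (fun n => φ ((W n *
            (((Real.sqrt (∑ i ∈ Finset.range n, σ i ^ 2) : ℝ) : ℂ)⁻¹ •
              (∑ i ∈ Finset.range n, X i)) * W n) ^ k))
          atTop (nhds (ψ (s ^ k))) := by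
  let _ : CStarAlgebra A := {}
  let _ : CStarAlgebra A' := {}
  exact strong_convergence_normalizedSum φ hφ hFa ψ hψ hFa' X σ hsa hfree hmean hvar hB hL4 V hV
    s hs
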